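/- arXiv:math/0601243 — 6 statements merged into one kernel-verified Lean document; each statement's English description precedes it below -/
import Mathlib

section
/- Let σ = (σ_t)_{t≥0} be a real-valued Lévy process with infinite lifetime, let λ > 0, and let T_λ be an exponential random variable of parameter λ independent of σ. Define Z(x) = P(σ_{T_λ} ≥ x) and z(x) = ∫_0^1 λ e^{−λt} P(σ_t ≥ x) dt for x ∈ ℝ. Then Z satisfies the renewal equation Z(x) = z(x) + e^{−λ} E( Z(x − σ_1) ) for every x ∈ ℝ. -/
open MeasureTheory ProbabilityTheory Filter Set Topology ENNReal

noncomputable section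

/-- A real-valued Lévy process with infinite lifetime: `ξ 0 = 0` a.s., càdlàg paths,
and stationary independent increments (on nonnegative times). -/
def IsLevyProcess {Ω : Type*} [MeasurableSpace Ω] (P : Measure Ω) (ξ : ℝ → Ω → ℝ) : Prop :=
  (∀ t : ℝ, Measurable (ξ t)) ∧
  (∀ᵐ ω ∂P, ξ 0 ω = 0) ∧
  (∀ᵐ ω ∂P, ∀ t : ℝ, 0 ≤ t → ContinuousWithinAt (fun s => ξ s ω) (Set.Ici t) t) ∧
  (∀ᵐ ω ∂P, ∀ t : ℝ, 0 < t →
    ∃ l : ℝ, Tendsto (fun s => ξ s ω) (nhdsWithin t (Set.Iio t)) (nhds l)) ∧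
  (∀ s t : ℝ, 0 ≤ s → s ≤ t →
    Indep (MeasurableSpace.comap (fun ω => ξ t ω - ξ s ω) inferInstance)
      (⨆ u ∈ Set.Icc (0 : ℝ) s, MeasurableSpace.comap (ξ u) inferInstance) P) ∧
  (∀ s t : ℝ, 0 ≤ s → s ≤ t →
    Measure.map (fun ω => ξ t ω - ξ s ω) P = Measure.map (ξ (t - s)) P)

/-- `T` is an exponential random variable of parameter `lam` under `P`. -/
def IsExponentialRV {Ω : Type*} [MeasurableSpace Ω] (P : Measure Ω) (lam : ℝ) (T : Ω → ℝ) :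
    Prop :=
  Measurable T ∧ ∀ t : ℝ, 0 ≤ t → P {ω | T ω > t} = ENNReal.ofReal (Real.exp (-(lam * t)))

/-- The values of a process at the positive times `(k + 1) / (n + 1)`. -/
def gridSample {Ω : Type*} (ξ : ℝ → Ω → ℝ) (ω : Ω) (p : ℕ × ℕ) : ℝ :=
  ξ ((p.2 + 1) / (p.1 + 1)) ω

/-- The right limit at time `t` (as a limsup) of a path known on the grid `(k + 1) / (n + 1)`. -/
def gridLimsup (t : ℝ) (w : ℕ × ℕ → ℝ) : EReal :=
  limsup (fun n : ℕ => ((w (n, ⌊((n : ℝ) + 1) * t⌋₊) : ℝ) : EReal)) atTop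

lemma measurable_gridSample {Ω : Type*} {m : MeasurableSpace Ω} {ξ : ℝ → Ω → ℝ}
    (hξ : ∀ t, 0 ≤ t → Measurable (ξ t)) : Measurable (gridSample ξ) :=
  measurable_pi_lambda _ fun p => hξ _ (by positivity)

lemma measurable_gridLimsup :
    Measurable (fun p : ℝ × (ℕ × ℕ → ℝ) => gridLimsup p.1 p.2) := by
  refine Measurable.limsup fun n => measurable_coe_real_ereal.comp ?_
  have h : Measurable (fun q : ℕ × (ℕ × ℕ → ℝ) => q.2 (n, q.1)) :=
    measurable_from_prod_countable_right fun k => measurable_pi_apply (n, k)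
  exact h.comp ((Nat.measurable_floor.comp (measurable_fst.const_mul _)).prodMk measurable_snd)

lemma tendsto_grid_nhdsWithin {t : ℝ} (ht : 0 ≤ t) :
    Tendsto (fun n : ℕ => ((⌊((n : ℝ) + 1) * t⌋₊ : ℝ) + 1) / ((n : ℝ) + 1)) atTop
      (𝓝[Ici t] t) := by
  have lower (n : ℕ) : t ≤ ((⌊((n : ℝ) + 1) * t⌋₊ : ℝ) + 1) / ((n : ℝ) + 1) := by
    rw [le_div_iff₀ (by positivity), mul_comm]
    exact (Nat.lt_floor_add_one _).le
  have upper (n : ℕ) :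
      ((⌊((n : ℝ) + 1) * t⌋₊ : ℝ) + 1) / ((n : ℝ) + 1) ≤ t + 1 / ((n : ℝ) + 1) := by
    have hn : (0 : ℝ) < n + 1 := by positivity
    rw [add_div]
    gcongr
    rw [div_le_iff₀ hn, mul_comm]
    exact Nat.floor_le (by positivity)
  refine tendsto_nhdsWithin_iff.2 ⟨?_, Eventually.of_forall lower⟩
  refine tendsto_of_tendsto_of_tendsto_of_le_of_le tendsto_const_nhds ?_ lower upper
  simpa using (tendsto_const_nhds (x := t)).add (tendsto_one_div_add_atTop_nhds_zero_nat (𝕜 := ℝ))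

lemma gridLimsup_gridSample {Ω : Type*} {ξ : ℝ → Ω → ℝ} {ω : Ω} {t : ℝ} (ht : 0 ≤ t)
    (h : ContinuousWithinAt (fun s => ξ s ω) (Ici t) t) :
    gridLimsup t (gridSample ξ ω) = (ξ t ω : EReal) :=
  Tendsto.limsup_eq <|
    (continuous_coe_real_ereal.tendsto _).comp (h.tendsto.comp (tendsto_grid_nhdsWithin ht))

/-- The tail `μ {w | y ≤ w_t}` of the time-`t` marginal of a law `μ` on grid samples. -/
def gridTail (μ : Measure (ℕ × ℕ → ℝ)) (t y : ℝ) : ℝ≥0∞ :=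
  μ {w | (y : EReal) ≤ gridLimsup t w}

lemma measurableSet_le_gridLimsup (y : ℝ) :
    MeasurableSet {p : ℝ × (ℕ × ℕ → ℝ) | (y : EReal) ≤ gridLimsup p.1 p.2} :=
  measurableSet_le measurable_const measurable_gridLimsup

lemma measurable_gridTail (μ : Measure (ℕ × ℕ → ℝ)) [SFinite μ] :
    Measurable (fun p : ℝ × ℝ => gridTail μ p.1 p.2) := by
  have h : MeasurableSet
      {q : (ℝ × ℝ) × (ℕ × ℕ → ℝ) | (q.1.2 : EReal) ≤ gridLimsup q.1.1 q.2} :=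
    measurableSet_le
      (measurable_coe_real_ereal.comp (f := fun q : (ℝ × ℝ) × (ℕ × ℕ → ℝ) => q.1.2)
        (measurable_snd.comp measurable_fst))
      (measurable_gridLimsup.comp (f := fun q : (ℝ × ℝ) × (ℕ × ℕ → ℝ) => (q.1.1, q.2))
        ((measurable_fst.comp measurable_fst).prodMk measurable_snd))
  exact measurable_measure_prodMk_left (ν := μ) h

lemma gridTail_le_one (μ : Measure (ℕ × ℕ → ℝ)) [IsProbabilityMeasure μ] (t y : ℝ) :
    gridTail μ t y ≤ 1 := prob_le_one

/-- For a right-continuous process, `gridTail` of the law of its grid sample is the tail of its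
marginals. -/
lemma gridTail_map_gridSample {Ω : Type*} [MeasurableSpace Ω] {P : Measure Ω} {ξ : ℝ → Ω → ℝ}
    (hξ : ∀ t, Measurable (ξ t))
    (hc : ∀ᵐ ω ∂P, ∀ t : ℝ, 0 ≤ t → ContinuousWithinAt (fun s => ξ s ω) (Ici t) t)
    {t : ℝ} (ht : 0 ≤ t) (y : ℝ) :
    gridTail (P.map (gridSample ξ)) t y = P {ω | ξ t ω ≥ y} := by
  have hS : MeasurableSet {w | (y : EReal) ≤ gridLimsup t w} :=
    measurable_prodMk_left (measurableSet_le_gridLimsup y)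
  rw [gridTail, Measure.map_apply (measurable_gridSample fun t _ => hξ t) hS]
  refine measure_congr ?_
  filter_upwards [hc] with ω hω
  apply propext
  change (y : EReal) ≤ gridLimsup t (gridSample ξ ω) ↔ y ≤ ξ t ω
  rw [gridLimsup_gridSample ht (hω t ht), EReal.coe_le_coe_iff]

/-- Tail of a right-continuous process at an independent nonnegative random time. -/
lemma measure_le_at_indep_time {Ω : Type*} [MeasurableSpace Ω] {P : Measure Ω}
    [IsProbabilityMeasure P] {ξ : ℝ → Ω → ℝ} (hξ : ∀ t, Measurable (ξ t))
    (hc : ∀ᵐ ω ∂P, ∀ t : ℝ, 0 ≤ t → ContinuousWithinAt (fun s => ξ s ω) (Ici t) t)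
    {T : Ω → ℝ} (hT : Measurable T) (hT0 : ∀ᵐ ω ∂P, 0 ≤ T ω)
    (hind : Indep (MeasurableSpace.comap T inferInstance)
      (⨆ t ∈ Ici (0 : ℝ), MeasurableSpace.comap (ξ t) inferInstance) P) (y : ℝ) :
    P {ω | ξ (T ω) ω ≥ y} = ∫⁻ t, gridTail (P.map (gridSample ξ)) t y ∂(P.map T) := by
  have hX : Measurable (gridSample ξ) := measurable_gridSample fun t _ => hξ t
  have hle : MeasurableSpace.comap (gridSample ξ) inferInstance ≤
      ⨆ t ∈ Ici (0 : ℝ), MeasurableSpace.comap (ξ t) inferInstance := by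
    refine Measurable.comap_le (measurable_gridSample fun t ht => ?_)
    exact measurable_iff_comap_le.2
      (le_iSup₂_of_le (f := fun t (_ : t ∈ Ici (0 : ℝ)) =>
        MeasurableSpace.comap (ξ t) inferInstance) t ht le_rfl)
  have hTX : T ⟂ᵢ[P] gridSample ξ :=
    (IndepFun_iff_Indep _ _ _).2 (indep_of_indep_of_le_right hind hle)
  have hlaw := (indepFun_iff_map_prod_eq_prod_map_map hT.aemeasurable hX.aemeasurable).1 hTX
  have hS := measurableSet_le_gridLimsup y
  calc P {ω | ξ (T ω) ω ≥ y}
      = P ((fun ω => (T ω, gridSample ξ ω)) ⁻¹' {p | (y : EReal) ≤ gridLimsup p.1 p.2}) := by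
        refine measure_congr ?_
        filter_upwards [hc, hT0] with ω hω h0
        apply propext
        change y ≤ ξ (T ω) ω ↔ (y : EReal) ≤ gridLimsup (T ω) (gridSample ξ ω)
        rw [gridLimsup_gridSample h0 (hω _ h0), EReal.coe_le_coe_iff]
    _ = ((P.map T).prod (P.map (gridSample ξ))) {p | (y : EReal) ≤ gridLimsup p.1 p.2} := by
        rw [← hlaw, Measure.map_apply (hT.prodMk hX) hS]
    _ = _ := Measure.prod_apply hS

lemma IsExponentialRV.map_eq_expMeasure {Ω : Type*} [MeasurableSpace Ω] {P : Measure Ω}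
    [IsProbabilityMeasure P] {lam : ℝ} (hlam : 0 < lam) {T : Ω → ℝ}
    (hT : IsExponentialRV P lam T) : P.map T = expMeasure lam := by
  have := isProbabilityMeasure_expMeasure hlam
  have := Measure.isProbabilityMeasure_map (μ := P) hT.1.aemeasurable
  have key (x : ℝ) (hx : 0 ≤ x) : cdf (P.map T) x = 1 - Real.exp (-(lam * x)) := by
    have h : (P.map T).real (Ioi x) = Real.exp (-(lam * x)) := by
      rw [measureReal_def, Measure.map_apply hT.1 measurableSet_Ioi]
      change (P {ω | T ω > x}).toReal = _
      rw [hT.2 x hx, ENNReal.toReal_ofReal (Real.exp_pos _).le]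
    rw [cdf_eq_real, ← h, ← compl_Iic, probReal_compl_eq_one_sub measurableSet_Iic]
    ring
  refine Measure.eq_of_cdf _ _ (StieltjesFunction.ext fun x => ?_)
  rw [cdf_expMeasure_eq hlam]
  split_ifs with hx
  · exact key x hx
  · refine le_antisymm ?_ (cdf_nonneg _ _)
    calc cdf (P.map T) x ≤ cdf (P.map T) 0 := monotone_cdf _ (not_le.1 hx).le
      _ = 0 := by simp [key 0 le_rfl]

lemma lintegral_expMeasure (lam : ℝ) {f : ℝ → ℝ≥0∞} (hf : Measurable f) :
    ∫⁻ t, f t ∂(expMeasure lam) =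
      ∫⁻ t in Ioi 0, ENNReal.ofReal (lam * Real.exp (-(lam * t))) * f t := by
  have hm : Measurable (exponentialPDF lam) :=
    (measurable_exponentialPDFReal lam).ennreal_ofReal
  have hd : expMeasure lam = volume.withDensity (exponentialPDF lam) := rfl
  rw [hd, lintegral_withDensity_eq_lintegral_mul _ hm hf, setLIntegral_congr Ioi_ae_eq_Ici,
    ← lintegral_indicator measurableSet_Ici]
  refine lintegral_congr fun t => ?_
  by_cases ht : 0 ≤ t
  · simp [ht, exponentialPDF_of_nonneg ht]
  · simp [ht, exponentialPDF_of_neg (not_le.1 ht)]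

/-- Splitting at time one, in view of the lack of memory of the exponential law. -/
lemma lintegral_expMeasure_eq_add (lam : ℝ) {f : ℝ → ℝ≥0∞}
    (hf : Measurable f) :
    ∫⁻ t, f t ∂(expMeasure lam) =
      (∫⁻ t in Ioc 0 1, ENNReal.ofReal (lam * Real.exp (-(lam * t))) * f t) +
        ENNReal.ofReal (Real.exp (-lam)) * ∫⁻ t, f (t + 1) ∂(expMeasure lam) := by
  rw [lintegral_expMeasure lam hf, lintegral_expMeasure lam (f := fun t => f (t + 1)) (hf.comp (measurable_add_const 1)),
    ← Ioc_union_Ioi_eq_Ioi (zero_le_one' ℝ),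
    lintegral_union measurableSet_Ioi (Ioc_disjoint_Ioi le_rfl),
    Ioc_union_Ioi_eq_Ioi (zero_le_one' ℝ),
    ← lintegral_const_mul' _ _ ENNReal.ofReal_ne_top]
  congr 1
  rw [← lintegral_indicator measurableSet_Ioi, ← lintegral_indicator measurableSet_Ioi,
    ← lintegral_add_right_eq_self _ (1 : ℝ)]
  refine lintegral_congr fun t => ?_
  by_cases ht : 0 < t
  · have ht' : 1 < t + 1 := by linarith
    simp only [indicator, mem_Ioi, ht, ht', if_true]
    rw [← mul_assoc, ← ENNReal.ofReal_mul (Real.exp_pos _).le, mul_left_comm, ← Real.exp_add]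
    congr 4
    ring
  · simp [indicator, ht]

/-- The Markov property of a Lévy process at a fixed time, for tails. -/
lemma IsLevyProcess.measure_le_add {Ω : Type*} [MeasurableSpace Ω] {P : Measure Ω}
    [IsProbabilityMeasure P] {ξ : ℝ → Ω → ℝ} (h : IsLevyProcess P ξ) {s t : ℝ}
    (hs : 0 ≤ s) (ht : 0 ≤ t) (y : ℝ) :
    P {ω | ξ (t + s) ω ≥ y} = ∫⁻ ω, P {ω' | ξ t ω' ≥ y - ξ s ω} ∂P := by
  obtain ⟨hm, -, -, -, hind, hstat⟩ := h
  have hle : s ≤ t + s := by linarith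
  have hI : (ξ s) ⟂ᵢ[P] (fun ω => ξ (t + s) ω - ξ s ω) := by
    refine ((IndepFun_iff_Indep _ _ _).2 (indep_of_indep_of_le_right (hind s (t + s) hs hle)
      ?_)).symm
    exact le_iSup₂_of_le (f := fun u (_ : u ∈ Icc (0 : ℝ) s) =>
        MeasurableSpace.comap (ξ u) inferInstance) s ⟨hs, le_rfl⟩ le_rfl
  have hinc : Measurable (fun ω => ξ (t + s) ω - ξ s ω) := (hm _).sub (hm _)
  have hlaw := (indepFun_iff_map_prod_eq_prod_map_map (hm s).aemeasurable hinc.aemeasurable).1 hI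
  have hst := hstat s (t + s) hs hle
  rw [add_sub_cancel_right] at hst
  rw [hst] at hlaw
  have hS : MeasurableSet {p : ℝ × ℝ | y ≤ p.1 + p.2} :=
    measurableSet_le measurable_const (measurable_fst.add measurable_snd)
  have hset : {ω | ξ (t + s) ω ≥ y} =
      (fun ω => (ξ s ω, ξ (t + s) ω - ξ s ω)) ⁻¹' {p | y ≤ p.1 + p.2} := by
    ext ω
    simp
  rw [hset, ← Measure.map_apply ((hm s).prodMk hinc) hS, hlaw, Measure.prod_apply hS,
    lintegral_map (measurable_measure_prodMk_left hS) (hm s)]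
  refine lintegral_congr fun ω => ?_
  rw [Measure.map_apply (hm t) (measurable_prodMk_left hS)]
  congr 1
  ext ω'
  simp [add_comm]

/-- For a Lévy process `σ` and an independent exponential time `T` of
parameter `λ > 0`, the function `Z(x) = P(σ_T ≥ x)` satisfies the renewal equation
`Z(x) = z(x) + e^{-λ} E(Z(x - σ₁))` where `z(x) = ∫_0^1 λ e^{-λt} P(σ_t ≥ x) dt`. -/
theorem levy_exponential_time_renewal_equation
    {Ω : Type*} [MeasurableSpace Ω] (P : Measure Ω) [IsProbabilityMeasure P]
    (σ : ℝ → Ω → ℝ) (hLevy : IsLevyProcess P σ)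
    (lam : ℝ) (hlam : 0 < lam)
    (T : Ω → ℝ) (hT : IsExponentialRV P lam T)
    (hTind : Indep (MeasurableSpace.comap T inferInstance)
      (⨆ t ∈ Set.Ici (0 : ℝ), MeasurableSpace.comap (σ t) inferInstance) P)
    (Z z : ℝ → ℝ)
    (hZ : ∀ x : ℝ, Z x = (P {ω | σ (T ω) ω ≥ x}).toReal)
    (hz : ∀ x : ℝ, z x =
      ∫ t in (0:ℝ)..1, lam * Real.exp (-(lam * t)) * (P {ω | σ t ω ≥ x}).toReal) :
    ∀ x : ℝ, Z x = z x + Real.exp (-lam) * ∫ ω, Z (x - σ 1 ω) ∂P := by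
  intro x
  obtain ⟨hm, -, hc, -⟩ := id hLevy
  have hX : Measurable (gridSample σ) := measurable_gridSample fun t _ => hm t
  have hμ := Measure.isProbabilityMeasure_map (μ := P) hX.aemeasurable
  have hν := isProbabilityMeasure_expMeasure hlam
  set μ := P.map (gridSample σ) with hμ_def
  have hT0 : ∀ᵐ ω ∂P, 0 ≤ T ω := by
    have h : P {ω | T ω > 0} = 1 := by simpa using hT.2 0 le_rfl
    have h' : ∀ᵐ ω ∂P, T ω > 0 :=
      (prob_compl_eq_zero_iff (measurableSet_lt measurable_const hT.1)).2 h
    exact h'.mono fun ω hω => hω.le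
  have hν0 : ∀ᵐ t ∂(expMeasure lam), 0 ≤ t := by
    rw [← hT.map_eq_expMeasure hlam]
    exact (ae_map_iff hT.1.aemeasurable measurableSet_Ici).2 hT0
  have hG := measurable_gridTail μ
  have hGt (y : ℝ) : Measurable (fun t => gridTail μ t y) := hG.comp measurable_prodMk_right
  have hGσ {t : ℝ} (ht : 0 ≤ t) (y : ℝ) : gridTail μ t y = P {ω | σ t ω ≥ y} :=
    gridTail_map_gridSample hm hc ht y
  have hZG (y : ℝ) : Z y = (∫⁻ t, gridTail μ t y ∂(expMeasure lam)).toReal := by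
    rw [hZ, measure_le_at_indep_time hm hc hT.1 hT0 hTind, hT.map_eq_expMeasure hlam]
  have hfin (y : ℝ) : ∫⁻ t, gridTail μ t y ∂(expMeasure lam) < ∞ :=
    (lintegral_mono fun t => gridTail_le_one μ t y).trans_lt (by simp)
  have hshift : ∫⁻ t, gridTail μ (t + 1) x ∂(expMeasure lam) =
      ∫⁻ ω, ∫⁻ t, gridTail μ t (x - σ 1 ω) ∂(expMeasure lam) ∂P := by
    rw [← lintegral_lintegral_swap]
    · refine lintegral_congr_ae ?_
      filter_upwards [hν0] with t ht
      rw [hGσ (by linarith), hLevy.measure_le_add zero_le_one ht]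
      exact lintegral_congr fun ω => (hGσ ht _).symm
    · exact (hG.comp (measurable_fst.prodMk
        (measurable_const.sub ((hm 1).comp measurable_snd)))).aemeasurable
  have hEZ : ∫ ω, Z (x - σ 1 ω) ∂P =
      (∫⁻ t, gridTail μ (t + 1) x ∂(expMeasure lam)).toReal := by
    simp_rw [hZG, hshift]
    refine integral_toReal ?_ (Eventually.of_forall fun ω => hfin _)
    have h : Measurable (fun y => ∫⁻ t, gridTail μ t y ∂(expMeasure lam)) :=
      Measurable.lintegral_prod_left' hG
    exact (h.comp (measurable_const.sub (hm 1))).aemeasurable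
  have hzG : z x = (∫⁻ t in Ioc 0 1,
      ENNReal.ofReal (lam * Real.exp (-(lam * t))) * gridTail μ t x).toReal := by
    rw [hz, intervalIntegral.integral_of_le zero_le_one, ← integral_toReal]
    · refine setIntegral_congr_fun measurableSet_Ioc fun t ht => ?_
      rw [ENNReal.toReal_mul, ENNReal.toReal_ofReal (by positivity), hGσ ht.1.le]
    · exact (Measurable.mul (by fun_prop) (hGt x)).aemeasurable
    · exact Eventually.of_forall fun t => ENNReal.mul_lt_top ENNReal.ofReal_lt_top
        ((gridTail_le_one μ t x).trans_lt ENNReal.one_lt_top)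
  have hsplit := lintegral_expMeasure_eq_add lam (hGt x)
  have hsum := hsplit ▸ hfin x
  rw [ENNReal.add_lt_top] at hsum
  rw [hZG, hsplit, ENNReal.toReal_add hsum.1.ne hsum.2.ne, ENNReal.toReal_mul,
    ENNReal.toReal_ofReal (Real.exp_pos _).le, hzG, hEZ]

end
end

section
/- Let f : [0,∞) → ℝ be measurable with s ↦ e^{f(s)} locally integrable, A(s) = ∫_0^s e^{f(u)} du, A_∞ = ∫_0^∞ e^{f(u)} du ∈ (0, ∞], and τ(t) = inf{s ≥ 0 : A(s) > t}. Then for every β ∈ ℝ, ∫_0^{A_∞} e^{β f(τ(t))} dt = ∫_0^∞ e^{(β+1) f(s)} ds, as an identity in [0, ∞]. -/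
open MeasureTheory Filter Set Topology ENNReal

noncomputable section

/-- A continuous strictly increasing distribution function started at `0` pushes its measure
forward to Lebesgue measure on `[0, μ univ)`. -/
theorem map_distribution_eq_volume_restrict {μ : Measure ℝ} {B : ℝ → ℝ} (hB : Continuous B)
    (hmono : StrictMono B) (hB0 : B 0 = 0)
    (hμ : ∀ s, μ (Iic s) = ENNReal.ofReal (B s)) :
    μ.map B = volume.restrict {t : ℝ | 0 ≤ t ∧ ENNReal.ofReal t < μ univ} := by
  have hIic : ∀ b : ℝ, μ.map B (Iic b) =
      volume.restrict {t : ℝ | 0 ≤ t ∧ ENNReal.ofReal t < μ univ} (Iic b) := by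
    intro b
    rw [Measure.map_apply hB.measurable measurableSet_Iic, Measure.restrict_apply measurableSet_Iic]
    rcases lt_or_ge b 0 with hb | hb
    · have h1 : Iic b ∩ {t : ℝ | 0 ≤ t ∧ ENNReal.ofReal t < μ univ} = ∅ :=
        eq_empty_of_forall_notMem fun t ht => (ht.1.trans_lt hb).not_ge ht.2.1
      have h2 : B ⁻¹' Iic b ⊆ Iic 0 := fun s hs =>
        hmono.le_iff_le.1 ((le_trans hs hb.le).trans_eq hB0.symm)
      rw [h1, measure_empty]
      refine measure_mono_null h2 ?_
      simp [hμ, hB0]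
    rcases lt_or_ge (ENNReal.ofReal b) (μ univ) with hlt | hge
    · obtain ⟨s, hs⟩ := ((tendsto_measure_Iic_atTop μ).eventually_const_lt hlt).exists
      rw [hμ] at hs
      have hbs : b < B s := (ENNReal.ofReal_lt_ofReal_iff_of_nonneg hb).1 hs
      obtain ⟨r, rfl⟩ := mem_range_of_exists_le_of_exists_ge hB
        ⟨0, hB0.trans_le hb⟩ ⟨s, hbs.le⟩
      have h1 : Iic (B r) ∩ {t : ℝ | 0 ≤ t ∧ ENNReal.ofReal t < μ univ} = Icc 0 (B r) := by
        ext t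
        exact ⟨fun h => ⟨h.2.1, h.1⟩,
          fun h => ⟨h.2, h.1, (ENNReal.ofReal_le_ofReal h.2).trans_lt hlt⟩⟩
      have h2 : B ⁻¹' Iic (B r) = Iic r := by
        ext t
        exact hmono.le_iff_le
      rw [h1, h2, hμ, Real.volume_Icc, sub_zero]
    · have hfin : μ univ ≠ ∞ := (hge.trans_lt ENNReal.ofReal_lt_top).ne
      have h1 : Iic b ∩ {t : ℝ | 0 ≤ t ∧ ENNReal.ofReal t < μ univ} =
          Ico 0 (μ univ).toReal := by
        ext t
        constructor
        · rintro ⟨-, h0, ht⟩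
          exact ⟨h0, (ENNReal.ofReal_lt_iff_lt_toReal h0 hfin).1 ht⟩
        · rintro ⟨h0, ht⟩
          refine ⟨?_, h0, (ENNReal.ofReal_lt_iff_lt_toReal h0 hfin).2 ht⟩
          exact ht.le.trans (ENNReal.toReal_le_of_le_ofReal hb hge)
      have h2 : B ⁻¹' Iic b = univ := by
        refine eq_univ_of_forall fun s => ?_
        have := (hμ s).symm.trans_le ((measure_mono (subset_univ _)).trans hge)
        exact (ENNReal.ofReal_le_ofReal_iff hb).1 this
      rw [h1, h2, Real.volume_Ico, sub_zero, ENNReal.ofReal_toReal hfin]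
  have hfin : ∀ b : ℝ,
      volume.restrict {t : ℝ | 0 ≤ t ∧ ENNReal.ofReal t < μ univ} (Iic b) ≠ ∞ := by
    intro b
    rw [Measure.restrict_apply measurableSet_Iic]
    have hsub : Iic b ∩ {t : ℝ | 0 ≤ t ∧ ENNReal.ofReal t < μ univ} ⊆ Icc 0 b :=
      fun t ht => ⟨ht.2.1, ht.1⟩
    exact ((measure_mono hsub).trans_lt measure_Icc_lt_top).ne
  refine (Measure.ext_of_Ioc _ _ fun a b hab => ?_).symm
  rw [← Iic_sdiff_Iic, measure_sdiff (Iic_subset_Iic.2 hab.le) measurableSet_Iic.nullMeasurableSet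
    (hfin a), measure_sdiff (Iic_subset_Iic.2 hab.le) measurableSet_Iic.nullMeasurableSet
    (by rw [hIic]; exact hfin a), hIic, hIic]

/-- For `f` measurable with `e^f` locally integrable,
`A(s) = ∫_0^s e^{f(u)} du`, `A_∞ = ∫_0^∞ e^{f(u)} du ∈ (0,∞]` and
`τ(t) = inf{s ≥ 0 : A(s) > t}`, one has, for every `β ∈ ℝ`, the change-of-variables
identity `∫_0^{A_∞} e^{β f(τ(t))} dt = ∫_0^∞ e^{(β+1) f(s)} ds` in `[0,∞]`. -/
theorem lamperti_change_of_variables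
    (f : ℝ → ℝ) (hf : Measurable f)
    (hloc : ∀ s : ℝ, IntegrableOn (fun u => Real.exp (f u)) (Set.Icc 0 s))
    (A : ℝ → ℝ) (hA : ∀ s : ℝ, A s = ∫ u in (0:ℝ)..s, Real.exp (f u))
    (Ainf : ℝ≥0∞) (hAinf : Ainf = ∫⁻ u in Set.Ioi (0:ℝ), ENNReal.ofReal (Real.exp (f u)))
    (τ : ℝ → ℝ) (hτ : ∀ t : ℝ, τ t = sInf {s : ℝ | 0 ≤ s ∧ A s > t})
    (β : ℝ) :
    ∫⁻ t in {t : ℝ | 0 ≤ t ∧ ENNReal.ofReal t < Ainf},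
        ENNReal.ofReal (Real.exp (β * f (τ t))) =
      ∫⁻ s in Set.Ioi (0:ℝ), ENNReal.ofReal (Real.exp ((β + 1) * f s)) := by
  set h : ℝ → ℝ := fun u => if 0 ≤ u then Real.exp (f u) else 1 with hh
  have hpos : ∀ u, 0 < h u := fun u => by
    simp only [hh]; split_ifs <;> positivity
  have heq : ∀ u, 0 ≤ u → h u = Real.exp (f u) := fun u hu => if_pos hu
  have hintR : ∀ s, 0 ≤ s → IntervalIntegrable h volume 0 s := fun s hs => by
    refine (intervalIntegrable_iff_integrableOn_Ioc_of_le hs).2 ?_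
    exact ((hloc s).mono_set Ioc_subset_Icc_self).congr_fun
      (fun u hu => (heq u hu.1.le).symm) measurableSet_Ioc
  have hintL : ∀ s, s ≤ 0 → IntervalIntegrable h volume 0 s := fun s hs => by
    refine (intervalIntegrable_const (c := (1 : ℝ))).congr_ae ?_
    have h0 : ∀ᵐ u : ℝ, u ≠ 0 := by simp [ae_iff]
    refine (ae_restrict_iff' measurableSet_uIoc).2 ?_
    filter_upwards [h0] with u hu0 hu
    rw [uIoc_of_ge hs] at hu
    exact (if_neg (lt_of_le_of_ne hu.2 hu0).not_ge).symm
  have hint0 : ∀ s, IntervalIntegrable h volume 0 s := fun s =>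
    (le_total 0 s).elim (hintR s) (hintL s)
  have hint : ∀ a b, IntervalIntegrable h volume a b := fun a b =>
    (hint0 a).symm.trans (hint0 b)
  set B : ℝ → ℝ := fun s => ∫ u in (0:ℝ)..s, h u with hBdef
  have hB : Continuous B := intervalIntegral.continuous_primitive hint 0
  have hmono : StrictMono B := fun a b hab => by
    have := intervalIntegral.intervalIntegral_pos_of_pos (hint a b) hpos hab
    rw [← intervalIntegral.integral_interval_sub_left (hint 0 b) (hint 0 a)] at this
    exact sub_pos.1 this
  have hB0 : B 0 = 0 := intervalIntegral.integral_same
  have hAB : ∀ s, 0 ≤ s → A s = B s := fun s hs => by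
    rw [hA]
    refine intervalIntegral.integral_congr fun u hu => ?_
    rw [uIcc_of_le hs] at hu
    exact (heq u hu.1).symm
  have hρ : Measurable fun u => ENNReal.ofReal (Real.exp (f u)) := by fun_prop
  set μ : Measure ℝ :=
    (volume.restrict (Ioi 0)).withDensity fun u => ENNReal.ofReal (Real.exp (f u)) with hμdef
  have hμuniv : μ univ = Ainf := by
    rw [hμdef, withDensity_apply _ MeasurableSet.univ, Measure.restrict_univ, hAinf]
  have hμ : ∀ s, μ (Iic s) = ENNReal.ofReal (B s) := fun s => by
    rw [hμdef, withDensity_apply _ measurableSet_Iic, Measure.restrict_restrict measurableSet_Iic,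
      inter_comm, Ioi_inter_Iic]
    rcases le_total s 0 with hs | hs
    · rw [Ioc_eq_empty hs.not_gt, setLIntegral_empty,
        ENNReal.ofReal_of_nonpos (hB0 ▸ hmono.monotone hs)]
    · rw [← hAB s hs, hA, intervalIntegral.integral_of_le hs, ofReal_integral_eq_lintegral_ofReal
        ((hloc s).mono_set Ioc_subset_Icc_self) (ae_of_all _ fun u => (Real.exp_pos _).le)]
  have hτB : ∀ s, 0 < s → τ (B s) = s := fun s hs => by
    have hset : {r : ℝ | 0 ≤ r ∧ A r > B s} = Ioi s := by
      ext r
      constructor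
      · rintro ⟨h0, hr⟩
        rw [hAB r h0] at hr
        exact hmono.lt_iff_lt.1 hr
      · intro hr
        have h0 : 0 ≤ r := hs.le.trans (le_of_lt hr)
        exact ⟨h0, by rw [hAB r h0]; exact hmono hr⟩
    rw [hτ, hset, csInf_Ioi]
  rw [← hμuniv, ← map_distribution_eq_volume_restrict hB hmono hB0 hμ,
    (hB.measurable.measurableEmbedding hmono.injective).lintegral_map, hμdef,
    lintegral_withDensity_eq_lintegral_mul_non_measurable _ hρ
      (ae_of_all _ fun _ => ENNReal.ofReal_lt_top)]
  refine setLIntegral_congr_fun measurableSet_Ioi fun s hs => ?_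
  simp only [Pi.mul_apply, hτB s hs]
  rw [← ENNReal.ofReal_mul (Real.exp_pos _).le, ← Real.exp_add]
  congr 2
  ring

end
end

section
/- Let ξ = (ξ_t)_{t≥0} be a real-valued Lévy process with infinite lifetime, with E(e^{−γξ_1}) = e^{−κ} for some γ > 0 and κ > 0. Define A(s) = ∫_0^s e^{ξ_u} du, A_∞ = ∫_0^∞ e^{ξ_u} du, and τ(t) = inf{s ≥ 0 : A(s) > t}. Then for every x > 0, E( ∫_0^{x A_∞} ( x e^{ξ_{τ(t/x)}} )^{−(γ+1)} dt ) = x^{−γ}/κ. In particular, the process X_t = x e^{ξ_{τ(t/x)}} (the Lamperti transform of ξ started at x) satisfies ∫_0^∞ E(X_t^{−γ−1} 1_{t < x A_∞}) dt < ∞, hence E(X_t^{−γ−1} 1_{t < x A_∞}) < ∞ for almost every t > 0. -/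
open MeasureTheory ProbabilityTheory Filter Set Topology ENNReal

noncomputable section

/-- A real function on the line which is right-continuous with left limits. -/
structure IsCadlag (f : ℝ → ℝ) : Prop where
  right_cont : ∀ t, ContinuousWithinAt f (Ici t) t
  left_lim : ∀ t, ∃ l, Tendsto f (𝓝[<] t) (𝓝 l)

namespace IsCadlag

variable {f : ℝ → ℝ}

lemma comp_continuous (hf : IsCadlag f) {g : ℝ → ℝ} (hg : Continuous g) :
    IsCadlag (fun t => g (f t)) where
  right_cont t := hg.continuousAt.comp_continuousWithinAt (hf.right_cont t)
  left_lim t := let ⟨l, hl⟩ := hf.left_lim t; ⟨g l, (hg.tendsto l).comp hl⟩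

lemma countable_setOf_lt_left_lim (f : ℝ → ℝ) :
    {t | ∃ l, f t < l ∧ Tendsto f (𝓝[<] t) (𝓝 l)}.Countable := by
  have hc : (⋃ q : ℚ,
      {t ∈ Ioi (q : ℝ) | ∃ z, f t < z ∧ ∀ y ∈ Ioi (q : ℝ), y < t → z ≤ f y}).Countable :=
    countable_iUnion fun q => countable_image_gt_image_Iio_within _ f
  refine hc.mono ?_
  rintro t ⟨l, hl, ht⟩
  obtain ⟨z, hz, hzl⟩ := exists_between hl
  obtain ⟨a, ha, hsub⟩ := mem_nhdsLT_iff_exists_Ioo_subset.1 (ht.eventually (lt_mem_nhds hzl))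
  obtain ⟨q, haq, hqt⟩ := exists_rat_btwn (show a < t from ha)
  exact mem_iUnion.2 ⟨q, hqt, z, hz, fun y hy hyt => (hsub ⟨haq.trans hy, hyt⟩).le⟩

lemma countable_not_continuousAt (hf : IsCadlag f) : {t | ¬ ContinuousAt f t}.Countable := by
  refine ((countable_setOf_lt_left_lim f).union
    (countable_setOf_lt_left_lim fun t => -f t)).mono ?_
  intro t ht
  obtain ⟨l, hl⟩ := hf.left_lim t
  rcases lt_trichotomy (f t) l with h | h | h
  · exact Or.inl ⟨l, h, hl⟩
  · refine absurd ?_ ht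
    rw [← h] at hl
    exact continuousAt_iff_continuous_left'_right'.2
      ⟨hl, (hf.right_cont t).mono Ioi_subset_Ici_self⟩
  · exact Or.inr ⟨-l, neg_lt_neg h, hl.neg⟩

lemma measurable (hf : IsCadlag f) : Measurable f :=
  measurable_of_countable_not_continuousAt hf.countable_not_continuousAt

lemma locallyIntegrable (hf : IsCadlag f) : LocallyIntegrable f := by
  intro t
  have hm : ∀ l : Filter ℝ, StronglyMeasurableAtFilter f l volume := fun l =>
    hf.measurable.stronglyMeasurable.stronglyMeasurableAtFilter
  obtain ⟨l, hl⟩ := hf.left_lim t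
  have h1 : IntegrableAtFilter f (𝓝[<] t) volume :=
    (volume.finiteAt_nhdsWithin t _).integrableAtFilter_of_tendsto (hm _) hl
  have h2 : IntegrableAtFilter f (𝓝[≥] t) volume :=
    (volume.finiteAt_nhdsWithin t _).integrableAtFilter_of_tendsto (hm _) (hf.right_cont t)
  rw [← nhdsLT_sup_nhdsGE]
  exact IntegrableAtFilter.sup_iff.2 ⟨h1, h2⟩

end IsCadlag

/-- The additive functional `∫_0^s e^{f(u)} du` of a path `f`. -/
def expClock (f : ℝ → ℝ) (s : ℝ) : ℝ := ∫ u in (0:ℝ)..s, Real.exp (f u)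

/-- The total mass `∫_0^∞ e^{f(u)} du` of the additive functional. -/
def expClockTop (f : ℝ → ℝ) : ℝ≥0∞ := ∫⁻ u in Ioi (0:ℝ), ENNReal.ofReal (Real.exp (f u))

/-- The right-continuous inverse of `expClock f`. -/
def expClockInv (f : ℝ → ℝ) (t : ℝ) : ℝ := sInf {s : ℝ | 0 ≤ s ∧ expClock f s > t}

/-- The power `-(γ+1)` of the Lamperti transform of the path `f` started at `x`, killed at the
end of its lifetime. -/
def lampertiIntegrand (x γ : ℝ) (f : ℝ → ℝ) (t : ℝ) : ℝ≥0∞ :=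
  if ENNReal.ofReal t < ENNReal.ofReal x * expClockTop f
    then ENNReal.ofReal ((x * Real.exp (f (expClockInv f (t / x)))) ^ (-(γ + 1)))
    else 0

namespace IsCadlag

variable {f : ℝ → ℝ}

lemma intervalIntegrable_exp (hf : IsCadlag f) (a b : ℝ) :
    IntervalIntegrable (fun u => Real.exp (f u)) volume a b :=
  ((hf.comp_continuous Real.continuous_exp).locallyIntegrable.integrableOn_isCompact
    isCompact_uIcc).intervalIntegrable

lemma continuous_expClock (hf : IsCadlag f) : Continuous (expClock f) :=
  intervalIntegral.continuous_primitive hf.intervalIntegrable_exp 0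

lemma strictMono_expClock (hf : IsCadlag f) : StrictMono (expClock f) := by
  intro a b hab
  have h : expClock f b - expClock f a = ∫ u in a..b, Real.exp (f u) :=
    intervalIntegral.integral_interval_sub_left (hf.intervalIntegrable_exp _ _)
      (hf.intervalIntegrable_exp _ _)
  have := intervalIntegral.intervalIntegral_pos_of_pos (hf.intervalIntegrable_exp a b)
    (fun u => Real.exp_pos (f u)) hab
  linarith

lemma hasDerivAt_expClock (hf : IsCadlag f) {s : ℝ} (hs : ContinuousAt f s) :
    HasDerivAt (expClock f) (Real.exp (f s)) s :=
  intervalIntegral.integral_hasDerivAt_right (hf.intervalIntegrable_exp _ _)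
    (hf.measurable.exp.stronglyMeasurable.stronglyMeasurableAtFilter)
    (Real.continuous_exp.continuousAt.comp hs)

lemma expClockInv_expClock (hf : IsCadlag f) {s : ℝ} (hs : 0 ≤ s) :
    expClockInv f (expClock f s) = s := by
  have : {r : ℝ | 0 ≤ r ∧ expClock f r > expClock f s} = Ioi s := by
    ext r
    simp only [gt_iff_lt, mem_ofPred_eq, hf.strictMono_expClock.lt_iff_lt, mem_Ioi]
    exact ⟨fun h => h.2, fun h => ⟨hs.trans h.le, h⟩⟩
  rw [expClockInv, this, csInf_Ioi]

lemma ofReal_expClock (hf : IsCadlag f) {s : ℝ} (hs : 0 ≤ s) :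
    ENNReal.ofReal (expClock f s) = ∫⁻ u in Ioc 0 s, ENNReal.ofReal (Real.exp (f u)) := by
  rw [expClock, intervalIntegral.integral_of_le hs, ofReal_integral_eq_lintegral_ofReal]
  · exact (hf.intervalIntegrable_exp 0 s).1
  · exact ae_of_all _ fun u => (Real.exp_pos _).le

lemma tendsto_ofReal_expClock (hf : IsCadlag f) :
    Tendsto (fun n : ℕ => ENNReal.ofReal (expClock f n)) atTop (𝓝 (expClockTop f)) := by
  have hc : AECover (volume.restrict (Ioi (0:ℝ))) atTop (fun n : ℕ => Iic (n : ℝ)) :=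
    aecover_Iic tendsto_natCast_atTop_atTop
  refine (hc.lintegral_tendsto_of_countably_generated
    hf.measurable.exp.ennreal_ofReal.aemeasurable).congr fun n => ?_
  rw [hf.ofReal_expClock n.cast_nonneg, Measure.restrict_restrict measurableSet_Iic, inter_comm,
    Ioi_inter_Iic]

lemma expClock_image_Ioi (hf : IsCadlag f) {x : ℝ} (hx : 0 < x) :
    (fun s => x * expClock f s) '' Ioi 0 =
      Ioi 0 ∩ {t | ENNReal.ofReal t < ENNReal.ofReal x * expClockTop f} := by
  have h0 : expClock f 0 = 0 := intervalIntegral.integral_same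
  ext t
  constructor
  · rintro ⟨s, hs, rfl⟩
    have hs : 0 < s := hs
    have hpos : 0 < expClock f s := h0 ▸ hf.strictMono_expClock hs
    refine ⟨mul_pos hx hpos, ?_⟩
    show ENNReal.ofReal (x * expClock f s) < _
    rw [ENNReal.ofReal_mul hx.le]
    refine ENNReal.mul_lt_mul_right (by simpa using hx) ENNReal.ofReal_ne_top ?_
    calc ENNReal.ofReal (expClock f s) < ENNReal.ofReal (expClock f (s + 1)) :=
          (ENNReal.ofReal_lt_ofReal_iff_of_nonneg hpos.le).2 (hf.strictMono_expClock (lt_add_one s))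
      _ ≤ expClockTop f := by
          rw [hf.ofReal_expClock (by linarith)]
          exact lintegral_mono_set Ioc_subset_Ioi_self
  · rintro ⟨ht0, ht⟩
    have ht0 : 0 < t := ht0
    have ht : ENNReal.ofReal (t / x) < expClockTop f := by
      rw [ENNReal.ofReal_div_of_pos hx]
      exact ENNReal.div_lt_of_lt_mul' ht
    obtain ⟨n, hn⟩ := (hf.tendsto_ofReal_expClock.eventually (lt_mem_nhds ht)).exists
    have hn : t / x < expClock f n := ((ENNReal.ofReal_lt_ofReal_iff_of_nonneg (by positivity)).1 hn)
    obtain ⟨s, hs, hst⟩ := intermediate_value_Ioo n.cast_nonneg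
      (hf.continuous_expClock.continuousOn (s := Icc (0:ℝ) n)) ⟨by rw [h0]; positivity, hn⟩
    exact ⟨s, hs.1, by simp only [hst]; field_simp⟩

/-- Change of variables `t = x A(s)` along a path. -/
lemma lintegral_lampertiIntegrand (hf : IsCadlag f) {x : ℝ} (hx : 0 < x) (γ : ℝ) :
    ∫⁻ t in Ioi 0, lampertiIntegrand x γ f t =
      ENNReal.ofReal (x ^ (-γ)) * ∫⁻ s in Ioi 0, ENNReal.ofReal (Real.exp (-(γ * f s))) := by
  set h : ℝ → ℝ := fun s => x * expClock f s with hh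
  set g : ℝ → ℝ≥0∞ := fun t =>
    ENNReal.ofReal ((x * Real.exp (f (expClockInv f (t / x)))) ^ (-(γ + 1))) with hg
  set D : Set ℝ := {t | ¬ ContinuousAt f t} with hD
  have hDc : D.Countable := hf.countable_not_continuousAt
  have hmono : StrictMono h := fun a b hab =>
    mul_lt_mul_of_pos_left (hf.strictMono_expClock hab) hx
  have hae : (h '' (Ioi 0 \ D) : Set ℝ) =ᵐ[volume] h '' Ioi 0 := by
    rw [image_sdiff hmono.injective]
    exact sdiff_null_ae_eq_self ((hDc.image h).measure_zero volume)
  have hae' : (Ioi 0 \ D : Set ℝ) =ᵐ[volume] Ioi 0 :=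
    sdiff_null_ae_eq_self (hDc.measure_zero volume)
  have hS : MeasurableSet {t | ENNReal.ofReal t < ENNReal.ofReal x * expClockTop f} :=
    measurableSet_lt ENNReal.measurable_ofReal measurable_const
  calc ∫⁻ t in Ioi 0, lampertiIntegrand x γ f t
      = ∫⁻ t in Ioi 0, {t | ENNReal.ofReal t < ENNReal.ofReal x * expClockTop f}.indicator g t := by
        simp only [lampertiIntegrand, indicator_apply, mem_ofPred_eq, hg]
    _ = ∫⁻ t in h '' Ioi 0, g t := by
        rw [lintegral_indicator hS, Measure.restrict_restrict hS, inter_comm,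
          hf.expClock_image_Ioi hx]
    _ = ∫⁻ t in h '' (Ioi 0 \ D), g t := setLIntegral_congr hae.symm
    _ = ∫⁻ s in Ioi 0 \ D, ENNReal.ofReal |x * Real.exp (f s)| * g (h s) := by
        refine lintegral_image_eq_lintegral_abs_deriv_mul (measurableSet_Ioi.diff hDc.measurableSet)
          (fun s hs => ?_) hmono.injective.injOn g
        exact ((hf.hasDerivAt_expClock (not_not.1 hs.2)).const_mul x).hasDerivWithinAt
    _ = ∫⁻ s in Ioi 0, ENNReal.ofReal |x * Real.exp (f s)| * g (h s) := setLIntegral_congr hae'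
    _ = ∫⁻ s in Ioi 0, ENNReal.ofReal (x ^ (-γ)) * ENNReal.ofReal (Real.exp (-(γ * f s))) := by
        refine setLIntegral_congr_fun measurableSet_Ioi fun s hs => ?_
        have hs : 0 < s := hs
        have hpos : 0 < x * Real.exp (f s) := mul_pos hx (Real.exp_pos _)
        have : h s / x = expClock f s := by simp only [hh]; field_simp
        simp only [hg, this, hf.expClockInv_expClock hs.le]
        rw [abs_of_pos hpos, ← ENNReal.ofReal_mul hpos.le, ← ENNReal.ofReal_mul (by positivity)]
        congr 1
        calc x * Real.exp (f s) * (x * Real.exp (f s)) ^ (-(γ + 1))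
            = (x * Real.exp (f s)) ^ (1 + -(γ + 1)) := by
              rw [Real.rpow_add hpos, Real.rpow_one]
          _ = x ^ (-γ) * Real.exp (-(γ * f s)) := by
              rw [Real.mul_rpow hx.le (Real.exp_pos _).le, ← Real.exp_mul]
              ring_nf
    _ = _ := lintegral_const_mul' _ _ ENNReal.ofReal_ne_top

end IsCadlag

section Measurability

variable {Ω : Type*} [MeasurableSpace Ω] {Z : Ω → ℝ → ℝ}

/-- A measurable process with càdlàg paths is jointly measurable. -/
lemma measurable_uncurry_of_isCadlag (hZ : ∀ ω, IsCadlag (Z ω))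
    (hm : ∀ t, Measurable fun ω => Z ω t) : Measurable fun p : Ω × ℝ => Z p.1 p.2 := by
  set u : ℕ → ℝ → ℝ := fun n t => ((⌊t * (n + 1)⌋ : ℝ) + 1) / (n + 1) with hu
  have hut : ∀ n t, t ≤ u n t := fun n t => by
    rw [hu, le_div_iff₀ (by positivity)]
    exact (Int.lt_floor_add_one _).le
  have hlim : ∀ t, Tendsto (fun n => u n t) atTop (𝓝[≥] t) := fun t => by
    refine tendsto_nhdsWithin_iff.2 ⟨?_, Eventually.of_forall fun n => hut n t⟩
    have h1 : Tendsto (fun n : ℕ => t + 1 / ((n : ℝ) + 1)) atTop (𝓝 t) := by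
      simpa using tendsto_const_nhds.add (tendsto_one_div_add_atTop_nhds_zero_nat (𝕜 := ℝ))
    refine tendsto_of_tendsto_of_tendsto_of_le_of_le tendsto_const_nhds h1 (fun n => hut n t)
      fun n => ?_
    have hn : (0:ℝ) < n + 1 := by positivity
    rw [hu, div_le_iff₀ hn, add_mul, one_div_mul_cancel hn.ne']
    gcongr
    exact Int.floor_le _
  refine measurable_of_tendsto_metrizable (f := fun n (p : Ω × ℝ) => Z p.1 (u n p.2))
    (fun n => ?_) (tendsto_pi_nhds.2 fun p => ((hZ p.1).right_cont p.2).tendsto.comp (hlim p.2))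
  have h1 : Measurable fun p : Ω × ℤ => Z p.1 (((p.2 : ℝ) + 1) / (n + 1)) :=
    measurable_from_prod_countable_left fun k => hm (((k : ℝ) + 1) / (n + 1))
  exact h1.comp (measurable_fst.prodMk (measurable_snd.mul_const _).floor)

lemma measurable_expClock (hZ : ∀ ω, IsCadlag (Z ω)) (hm : ∀ t, Measurable fun ω => Z ω t)
    {s : ℝ} (hs : 0 ≤ s) : Measurable fun ω => expClock (Z ω) s := by
  simp only [expClock, intervalIntegral.integral_of_le hs]
  exact (StronglyMeasurable.integral_prod_right (f := fun ω u => Real.exp (Z ω u))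
    (measurable_uncurry_of_isCadlag hZ hm).exp.stronglyMeasurable).measurable

lemma measurable_expClockTop (hZ : ∀ ω, IsCadlag (Z ω)) (hm : ∀ t, Measurable fun ω => Z ω t) :
    Measurable fun ω => expClockTop (Z ω) :=
  (measurable_uncurry_of_isCadlag hZ hm).exp.ennreal_ofReal.lintegral_prod_right'

lemma expClockInv_lt_iff {f : ℝ → ℝ} (hf : IsCadlag f) (t s : ℝ) :
    expClockInv f t < s ↔ (∃ q : ℚ, 0 ≤ (q : ℝ) ∧ (q : ℝ) < s ∧ t < expClock f q) ∨
      (0 < s ∧ ∀ n : ℕ, expClock f n ≤ t) := by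
  set S : Set ℝ := {s : ℝ | 0 ≤ s ∧ expClock f s > t} with hS
  have hbdd : BddBelow S := ⟨0, fun r hr => hr.1⟩
  have hinv : expClockInv f t = sInf S := rfl
  rw [hinv]
  rcases S.eq_empty_or_nonempty with he | hne
  · have hall : ∀ r, 0 ≤ r → expClock f r ≤ t := fun r hr => by
      by_contra! h
      have : r ∈ S := ⟨hr, h⟩
      simp [he] at this
    rw [he, Real.sInf_empty]
    refine ⟨fun h => Or.inr ⟨h, fun n => hall n n.cast_nonneg⟩, ?_⟩
    rintro (⟨q, h0, -, h⟩ | h)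
    · exact absurd (hall q h0) h.not_ge
    · exact h.1
  · rw [csInf_lt_iff hbdd hne]
    constructor
    · rintro ⟨a, ⟨h0, ha⟩, has⟩
      obtain ⟨q, haq, hqs⟩ := exists_rat_btwn has
      exact Or.inl ⟨q, h0.trans haq.le, hqs, ha.trans (hf.strictMono_expClock haq)⟩
    · rintro (⟨q, h0, hq, h⟩ | ⟨-, h⟩)
      · exact ⟨q, ⟨h0, h⟩, hq⟩
      · obtain ⟨r, hr0, hr⟩ := hne
        obtain ⟨n, hn⟩ := exists_nat_ge r
        exact absurd (hr.trans_le (hf.strictMono_expClock.monotone hn)) (h n).not_gt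

lemma measurable_expClockInv (hZ : ∀ ω, IsCadlag (Z ω)) (hm : ∀ t, Measurable fun ω => Z ω t) :
    Measurable fun p : Ω × ℝ => expClockInv (Z p.1) p.2 := by
  refine measurable_of_Iio fun s => ?_
  have : (fun p : Ω × ℝ => expClockInv (Z p.1) p.2) ⁻¹' Iio s =
      {p | (∃ q : ℚ, 0 ≤ (q : ℝ) ∧ (q : ℝ) < s ∧ p.2 < expClock (Z p.1) q) ∨
        (0 < s ∧ ∀ n : ℕ, expClock (Z p.1) n ≤ p.2)} := by
    ext p
    exact expClockInv_lt_iff (hZ p.1) _ _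
  have hA : ∀ r : ℝ, 0 ≤ r → Measurable fun p : Ω × ℝ => expClock (Z p.1) r := fun r hr =>
    (measurable_expClock hZ hm hr).comp measurable_fst
  rw [this]
  simp only [ofPred_or, ofPred_and, ofPred_exists, ofPred_forall]
  refine MeasurableSet.union (MeasurableSet.iUnion fun q => ?_) ?_
  · by_cases hq : 0 ≤ (q : ℝ)
    · exact (MeasurableSet.const _).inter
        ((MeasurableSet.const _).inter (measurableSet_lt measurable_snd (hA q hq)))
    · simp [hq]
  · exact (MeasurableSet.const _).inter (MeasurableSet.iInter fun n =>
      measurableSet_le (hA n n.cast_nonneg) measurable_snd)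

lemma measurable_lampertiIntegrand (hZ : ∀ ω, IsCadlag (Z ω))
    (hm : ∀ t, Measurable fun ω => Z ω t) (x γ : ℝ) :
    Measurable fun p : Ω × ℝ => lampertiIntegrand x γ (Z p.1) p.2 := by
  refine Measurable.ite (measurableSet_lt (ENNReal.measurable_ofReal.comp measurable_snd)
    (((measurable_expClockTop hZ hm).comp measurable_fst).const_mul _)) ?_ measurable_const
  have h1 : Measurable fun p : Ω × ℝ => (p.1, expClockInv (Z p.1) (p.2 / x)) :=
    measurable_fst.prodMk ((measurable_expClockInv hZ hm).comp
      (measurable_fst.prodMk (measurable_snd.div_const x)))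
  exact ((((measurable_uncurry_of_isCadlag hZ hm).comp h1).exp.const_mul x).pow_const _).ennreal_ofReal

end Measurability

namespace IsLevyProcess

variable {Ω : Type*} [MeasurableSpace Ω] {P : Measure Ω} {ξ : ℝ → Ω → ℝ}

/-- Exponential moments of a Lévy process are multiplicative in time. -/
lemma lintegral_exp_add (h : IsLevyProcess P ξ) (γ : ℝ) {s t : ℝ} (hs : 0 ≤ s) (ht : 0 ≤ t) :
    ∫⁻ ω, ENNReal.ofReal (Real.exp (-(γ * ξ (s + t) ω))) ∂P =
      (∫⁻ ω, ENNReal.ofReal (Real.exp (-(γ * ξ s ω))) ∂P) *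
        ∫⁻ ω, ENNReal.ofReal (Real.exp (-(γ * ξ t ω))) ∂P := by
  obtain ⟨hm, -, -, -, hind, hstat⟩ := h
  have hg : Measurable fun y : ℝ => ENNReal.ofReal (Real.exp (-(γ * y))) := by fun_prop
  have hle : s ≤ s + t := le_add_of_nonneg_right ht
  have hI : (fun ω => ξ (s + t) ω - ξ s ω) ⟂ᵢ[P] ξ s :=
    (IndepFun_iff_Indep _ _ _).2 (indep_of_indep_of_le_right (hind s (s + t) hs hle)
      (le_iSup₂_of_le s ⟨hs, le_rfl⟩ le_rfl))
  have hY : Measurable fun ω => ξ (s + t) ω - ξ s ω := (hm _).sub (hm _)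
  have hinc : ∫⁻ ω, ENNReal.ofReal (Real.exp (-(γ * (ξ (s + t) ω - ξ s ω)))) ∂P =
      ∫⁻ ω, ENNReal.ofReal (Real.exp (-(γ * ξ t ω))) ∂P := by
    have hst := hstat s (s + t) hs hle
    rw [add_sub_cancel_left] at hst
    rw [← lintegral_map hg hY, ← lintegral_map hg (hm t)]
    exact congrArg (fun μ => ∫⁻ y, ENNReal.ofReal (Real.exp (-(γ * y))) ∂μ) hst
  rw [← hinc, mul_comm]
  refine Eq.trans ?_ (lintegral_mul_eq_lintegral_mul_lintegral_of_indepFun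
    (hg.comp hY) (hg.comp (hm s)) (hI.comp hg hg))
  refine lintegral_congr fun ω => ?_
  simp only [Pi.mul_apply]
  rw [← ENNReal.ofReal_mul (Real.exp_pos _).le, ← Real.exp_add]
  ring_nf

/-- The Laplace transform of a Lévy process is exponential in time. -/
lemma lintegral_exp_eq [IsProbabilityMeasure P] (h : IsLevyProcess P ξ) {γ κ : ℝ}
    (h1 : ∫⁻ ω, ENNReal.ofReal (Real.exp (-(γ * ξ 1 ω))) ∂P = ENNReal.ofReal (Real.exp (-κ)))
    {t : ℝ} (ht : 0 ≤ t) :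
    ∫⁻ ω, ENNReal.ofReal (Real.exp (-(γ * ξ t ω))) ∂P =
      ENNReal.ofReal (Real.exp (-(κ * t))) := by
  set M : ℝ → ℝ≥0∞ := fun t => ∫⁻ ω, ENNReal.ofReal (Real.exp (-(γ * ξ t ω))) ∂P with hM
  set e : ℝ → ℝ≥0∞ := fun t => ENNReal.ofReal (Real.exp (-(κ * t))) with he
  have hMadd : ∀ s t, 0 ≤ s → 0 ≤ t → M (s + t) = M s * M t := fun s t hs ht =>
    h.lintegral_exp_add γ hs ht
  have headd : ∀ s t, e (s + t) = e s * e t := fun s t => by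
    simp only [he]
    rw [← ENNReal.ofReal_mul (Real.exp_pos _).le, ← Real.exp_add]
    ring_nf
  have he0 : ∀ t, e t ≠ 0 := fun t => by simp [he, Real.exp_pos]
  have heT : ∀ t, e t ≠ ⊤ := fun t => ENNReal.ofReal_ne_top
  have hM0 : M 0 = 1 := by
    have : M 0 = ∫⁻ ω, 1 ∂P := by
      refine lintegral_congr_ae ?_
      filter_upwards [h.2.1] with ω hω
      simp [hω]
    simpa using this
  have hMnat : ∀ s, 0 ≤ s → ∀ n : ℕ, M (n * s) = M s ^ n := fun s hs n => by
    induction n with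
    | zero => simpa using hM0
    | succ n ih =>
      rw [Nat.cast_succ, add_mul, one_mul, hMadd _ _ (by positivity) hs, ih, pow_succ]
  have henat : ∀ s, ∀ n : ℕ, e (n * s) = e s ^ n := fun s n => by
    induction n with
    | zero => simp [he]
    | succ n ih => rw [Nat.cast_succ, add_mul, one_mul, headd, ih, pow_succ]
  have hM1 : M 1 = e 1 := by simpa [he] using h1
  have hroot : ∀ n : ℕ, n ≠ 0 → M (1 / n) = e (1 / n) := fun n hn => by
    have hn' : (n : ℝ) * (1 / n) = 1 := by field_simp
    have hpow : M (1 / n) ^ n = e (1 / n) ^ n := by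
      rw [← hMnat _ (by positivity), ← henat, hn', hM1]
    rcases lt_trichotomy (M (1 / n)) (e (1 / n)) with hlt | heq | hlt
    · exact absurd hpow (ENNReal.pow_lt_pow_left hn hlt).ne
    · exact heq
    · exact absurd hpow (ENNReal.pow_lt_pow_left hn hlt).ne'
  have hrat : ∀ n k : ℕ, n ≠ 0 → M ((k : ℝ) / n) = e ((k : ℝ) / n) := fun n k hn => by
    rw [show (k : ℝ) / n = k * (1 / n) by ring, hMnat _ (by positivity), henat, hroot n hn]
  have hupper : ∀ t, 0 ≤ t → M t ≤ e t := fun t ht => by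
    set u : ℕ → ℝ := fun n => (⌈t * ((n + 1 : ℕ) : ℝ)⌉₊ : ℝ) / ((n + 1 : ℕ) : ℝ) with hu
    have hut : ∀ n, t ≤ u n := fun n => by
      rw [hu, le_div_iff₀ (by positivity)]
      exact Nat.le_ceil _
    have hulim : Tendsto u atTop (𝓝 t) :=
      (tendsto_nat_ceil_mul_div_atTop ht).comp
        (tendsto_natCast_atTop_atTop.comp (tendsto_add_atTop_nat 1))
    have hecont : Continuous e := ENNReal.continuous_ofReal.comp (by fun_prop)
    have hc : Continuous fun y : ℝ => ENNReal.ofReal (Real.exp (-(γ * y))) :=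
      ENNReal.continuous_ofReal.comp (by fun_prop)
    calc M t = ∫⁻ ω, liminf (fun n => ENNReal.ofReal (Real.exp (-(γ * ξ (u n) ω)))) atTop ∂P := by
          refine lintegral_congr_ae ?_
          filter_upwards [h.2.2.1] with ω hω
          have h2 : Tendsto (fun n => ξ (u n) ω) atTop (𝓝 (ξ t ω)) :=
            (hω t ht).tendsto.comp (tendsto_nhdsWithin_iff.2
              ⟨hulim, Eventually.of_forall hut⟩)
          exact ((hc.tendsto _).comp h2).liminf_eq.symm
      _ ≤ liminf (fun n => M (u n)) atTop :=
          lintegral_liminf_le fun n => hc.measurable.comp (h.1 _)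
      _ = liminf (fun n => e (u n)) atTop := by
          simp only [hu, hrat _ _ (Nat.succ_ne_zero _)]
      _ = e t := ((hecont.tendsto _).comp hulim).liminf_eq
  refine le_antisymm (hupper t ht) ?_
  obtain ⟨n, hn⟩ := exists_nat_ge t
  have hnt : 0 ≤ n - t := sub_nonneg.2 hn
  have hprod : e t * e (n - t) ≤ M t * e (n - t) :=
    calc e t * e (n - t) = M n := by
          have := hrat 1 n one_ne_zero
          rw [Nat.cast_one, div_one] at this
          rw [← headd, add_sub_cancel, this]
      _ = M t * M (n - t) := by rw [← hMadd _ _ ht hnt, add_sub_cancel]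
      _ ≤ M t * e (n - t) := by gcongr; exact hupper _ hnt
  exact (ENNReal.mul_le_mul_iff_left (he0 _) (heT _)).1 hprod

/-- A Lévy process agrees almost surely, on nonnegative times, with a process all of whose paths
are càdlàg. -/
lemma exists_isCadlag_modification (h : IsLevyProcess P ξ) :
    ∃ Z : Ω → ℝ → ℝ, (∀ ω, IsCadlag (Z ω)) ∧ (∀ t, Measurable fun ω => Z ω t) ∧
      ∀ᵐ ω ∂P, ∀ t, 0 ≤ t → Z ω t = ξ t ω := by
  classical
  obtain ⟨hm, -, hr, hl, -, -⟩ := h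
  set N : Set Ω := {ω | ¬ ((∀ t : ℝ, 0 ≤ t → ContinuousWithinAt (fun s => ξ s ω) (Ici t) t) ∧
    ∀ t : ℝ, 0 < t → ∃ l : ℝ, Tendsto (fun s => ξ s ω) (𝓝[<] t) (𝓝 l))} with hN
  have hNnull : P (toMeasurable P N) = 0 := by
    rw [measure_toMeasurable]
    exact ae_iff.1 (hr.and hl)
  refine ⟨fun ω t => if ω ∈ toMeasurable P N then 0 else ξ (max t 0) ω, fun ω => ?_, fun t => ?_, ?_⟩
  · by_cases hω : ω ∈ toMeasurable P N
    · simp only [hω, if_true]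
      exact ⟨fun t => continuousWithinAt_const, fun t => ⟨0, tendsto_const_nhds⟩⟩
    · simp only [hω, if_false]
      obtain ⟨hr, hl⟩ := not_not.1 fun h => hω (subset_toMeasurable P N h)
      refine ⟨fun t => ?_, fun t => ?_⟩
      · exact ContinuousWithinAt.comp (f := fun s => max s 0) (t := Ici (max t 0))
          (hr _ (le_max_right _ _))
          (by fun_prop) fun s hs => max_le_max_right 0 (mem_Ici.1 hs)
      · rcases le_or_gt t 0 with ht | ht
        · refine ⟨ξ 0 ω, tendsto_const_nhds.congr' ?_⟩
          filter_upwards [self_mem_nhdsWithin] with s hs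
          rw [max_eq_right ((le_of_lt hs).trans ht)]
        · obtain ⟨l, hl⟩ := hl t ht
          refine ⟨l, hl.congr' ?_⟩
          filter_upwards [mem_nhdsWithin_of_mem_nhds (Ioi_mem_nhds ht)] with s hs
          rw [max_eq_left (le_of_lt hs)]
  · exact Measurable.ite (measurableSet_toMeasurable P N) measurable_const (hm _)
  · filter_upwards [measure_eq_zero_iff_ae_notMem.1 hNnull] with ω hω t ht
    simp only [hω, if_false, max_eq_left ht]

end IsLevyProcess

lemma lintegral_ofReal_exp_neg_mul_Ioi {κ : ℝ} (hκ : 0 < κ) :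
    ∫⁻ s in Ioi (0:ℝ), ENNReal.ofReal (Real.exp (-(κ * s))) = ENNReal.ofReal (1 / κ) := by
  simp only [← neg_mul]
  rw [← ofReal_integral_eq_lintegral_ofReal (exp_neg_integrableOn_Ioi 0 hκ)
    (ae_of_all _ fun s => (Real.exp_pos _).le), integral_exp_mul_Ioi (neg_lt_zero.2 hκ)]
  simp

lemma expClock_congr {f g : ℝ → ℝ} (h : ∀ t, 0 ≤ t → f t = g t) {s : ℝ} (hs : 0 ≤ s) :
    expClock f s = expClock g s := by
  refine intervalIntegral.integral_congr fun u hu => ?_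
  rw [uIcc_of_le hs] at hu
  simp only [h u hu.1]

/-- The Lamperti transform only depends on the path on nonnegative times. -/
lemma lampertiIntegrand_congr {f g : ℝ → ℝ} (h : ∀ t, 0 ≤ t → f t = g t) (x γ t : ℝ) :
    lampertiIntegrand x γ f t = lampertiIntegrand x γ g t := by
  have htop : expClockTop f = expClockTop g :=
    setLIntegral_congr_fun measurableSet_Ioi fun u hu => by simp only [h u (le_of_lt hu)]
  have hinv : ∀ r, expClockInv f r = expClockInv g r := fun r => by
    unfold expClockInv
    congr 1
    ext s
    exact and_congr_right fun hs => by rw [expClock_congr h hs]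
  have hnonneg : ∀ r, 0 ≤ expClockInv f r := fun r => Real.sInf_nonneg fun s hs => hs.1
  rw [lampertiIntegrand, lampertiIntegrand, htop, h _ (hnonneg _), hinv]

/-- Let `ξ` be a Lévy process with `E(e^{-γξ₁}) = e^{-κ}`, `γ, κ > 0`.
With `A(s) = ∫_0^s e^{ξ_u} du`, `A_∞ = ∫_0^∞ e^{ξ_u} du`, `τ(t) = inf{s ≥ 0 : A(s) > t}`,
and `X_t = x e^{ξ_{τ(t/x)}}` the Lamperti transform started at `x > 0`, one has
`E(∫_0^{x A_∞} X_t^{-(γ+1)} dt) = x^{-γ}/κ`; in particular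
`∫_0^∞ E(X_t^{-γ-1} 1_{t < x A_∞}) dt < ∞` and `E(X_t^{-γ-1} 1_{t < x A_∞}) < ∞` for
almost every `t > 0`. -/
theorem lamperti_transform_negative_moment_integral
    {Ω : Type*} [MeasurableSpace Ω] (P : Measure Ω) [IsProbabilityMeasure P]
    (ξ : ℝ → Ω → ℝ) (hLevy : IsLevyProcess P ξ)
    (γ κ : ℝ) (hγ : 0 < γ) (hκ : 0 < κ)
    (hInt : Integrable (fun ω => Real.exp (-(γ * ξ 1 ω))) P)
    (hE : ∫ ω, Real.exp (-(γ * ξ 1 ω)) ∂P = Real.exp (-κ))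
    (A : Ω → ℝ → ℝ) (hA : ∀ ω, ∀ s : ℝ, A ω s = ∫ u in (0:ℝ)..s, Real.exp (ξ u ω))
    (Ainf : Ω → ℝ≥0∞)
    (hAinf : ∀ ω, Ainf ω = ∫⁻ u in Set.Ioi (0:ℝ), ENNReal.ofReal (Real.exp (ξ u ω)))
    (τ : Ω → ℝ → ℝ) (hτ : ∀ ω, ∀ t : ℝ, τ ω t = sInf {s : ℝ | 0 ≤ s ∧ A ω s > t})
    (x : ℝ) (hx : 0 < x)
    (F : Ω → ℝ → ℝ≥0∞)
    (hF : ∀ ω, ∀ t : ℝ, F ω t =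
      if ENNReal.ofReal t < ENNReal.ofReal x * Ainf ω
        then ENNReal.ofReal ((x * Real.exp (ξ (τ ω (t / x)) ω)) ^ (-(γ + 1)))
        else 0) :
    (∫⁻ ω, (∫⁻ t in Set.Ioi (0:ℝ), F ω t) ∂P) = ENNReal.ofReal (x ^ (-γ) / κ) ∧
    (∫⁻ t in Set.Ioi (0:ℝ), (∫⁻ ω, F ω t ∂P)) < ⊤ ∧
    (∀ᵐ t ∂(volume.restrict (Set.Ioi (0:ℝ))), (∫⁻ ω, F ω t ∂P) < ⊤) := by
  obtain ⟨Z, hZ, hZm, hZξ⟩ := hLevy.exists_isCadlag_modification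
  have hFξ : ∀ ω t, F ω t = lampertiIntegrand x γ (fun s => ξ s ω) t := fun ω t => by
    rw [hF, hAinf, hτ]
    simp only [hA]
    rfl
  have hFZ : ∀ᵐ ω ∂P, ∀ t, F ω t = lampertiIntegrand x γ (Z ω) t := by
    filter_upwards [hZξ] with ω hω t
    rw [hFξ, lampertiIntegrand_congr hω]
  have hmeas := measurable_lampertiIntegrand hZ hZm x γ
  have hM1 : ∫⁻ ω, ENNReal.ofReal (Real.exp (-(γ * ξ 1 ω))) ∂P =
      ENNReal.ofReal (Real.exp (-κ)) := by
    rw [← hE, ofReal_integral_eq_lintegral_ofReal hInt (ae_of_all _ fun ω => (Real.exp_pos _).le)]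
  have hmoment : ∀ s ∈ Ioi (0:ℝ), ∫⁻ ω, ENNReal.ofReal (Real.exp (-(γ * Z ω s))) ∂P =
      ENNReal.ofReal (Real.exp (-(κ * s))) := fun s hs => by
    rw [← hLevy.lintegral_exp_eq hM1 (le_of_lt hs)]
    refine lintegral_congr_ae ?_
    filter_upwards [hZξ] with ω hω
    rw [hω s (le_of_lt hs)]
  have hexp : Measurable fun p : Ω × ℝ => ENNReal.ofReal (Real.exp (-(γ * Z p.1 p.2))) :=
    ((measurable_uncurry_of_isCadlag hZ hZm).const_mul γ).neg.exp.ennreal_ofReal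
  have hmain : ∫⁻ ω, (∫⁻ t in Ioi (0:ℝ), lampertiIntegrand x γ (Z ω) t) ∂P =
      ENNReal.ofReal (x ^ (-γ) / κ) := by
    simp only [(hZ _).lintegral_lampertiIntegrand hx]
    rw [lintegral_const_mul' _ _ ENNReal.ofReal_ne_top, lintegral_lintegral_swap hexp.aemeasurable,
      setLIntegral_congr_fun measurableSet_Ioi hmoment, lintegral_ofReal_exp_neg_mul_Ioi hκ,
      ← ENNReal.ofReal_mul (by positivity), mul_one_div]
  have hinner : ∀ t, ∫⁻ ω, F ω t ∂P = ∫⁻ ω, lampertiIntegrand x γ (Z ω) t ∂P := fun t =>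
    lintegral_congr_ae (hFZ.mono fun ω hω => hω t)
  have hswap : ∫⁻ t in Ioi (0:ℝ), (∫⁻ ω, lampertiIntegrand x γ (Z ω) t ∂P) =
      ENNReal.ofReal (x ^ (-γ) / κ) := by
    rw [← hmain, ← lintegral_lintegral_swap hmeas.aemeasurable]
  simp only [hinner]
  refine ⟨?_, hswap ▸ ENNReal.ofReal_lt_top, ae_lt_top hmeas.lintegral_prod_left'
    (hswap ▸ ENNReal.ofReal_ne_top)⟩
  rw [← hmain]
  exact lintegral_congr_ae (hFZ.mono fun ω hω => lintegral_congr fun t => hω t)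

end
end

section
/- Let ξ = (ξ_t)_{t≥0} be a real-valued Lévy process with infinite lifetime, with no negative jumps (ξ_t ≥ ξ_{t−} for all t > 0, a.s.), which drifts to +∞ (lim_{t→∞} ξ_t = +∞ a.s.) and whose paths are not a.s. nondecreasing. Let I = inf_{t≥0} ξ_t. Then there exists γ > 0 such that for every x > 0 and every ε ≥ 0, P( x e^{I} ≤ ε ) = min( (ε/x)^γ , 1 ). -/
open MeasureTheory ProbabilityTheory Filter Set Topology ENNReal

noncomputable section

/-! ### Properties of real paths -/

/-- Along a right-continuous path, dyadic points slightly to the right of `t` inherit a strict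
upper bound on the value at `t`. -/
lemma eventually_exists_dyadic_lt {x : ℝ → ℝ} {t c r : ℝ} (ht : 0 ≤ t)
    (hx : ContinuousWithinAt x (Set.Ici t) t) (hc : x t < c) (hr : t < r) :
    ∀ᶠ n : ℕ in atTop, ∃ k : ℕ, (k : ℝ) / 2 ^ n ∈ Set.Ico t r ∧ x ((k : ℝ) / 2 ^ n) < c := by
  have hpow : Tendsto (fun n : ℕ => (2 : ℝ) ^ n) atTop atTop :=
    tendsto_pow_atTop_atTop_of_one_lt one_lt_two
  have hlim := (tendsto_nat_ceil_mul_div_atTop ht).comp hpow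
  have hge : ∀ n : ℕ, t ≤ (⌈t * 2 ^ n⌉₊ : ℝ) / 2 ^ n := fun n => by
    rw [le_div_iff₀ (by positivity)]
    exact Nat.le_ceil _
  have hwithin := tendsto_nhdsWithin_iff.2 ⟨hlim, Eventually.of_forall hge⟩
  filter_upwards [hlim.eventually_lt_const hr,
    (hx.tendsto.comp hwithin).eventually_lt_const hc] with n hn hn'
  exact ⟨_, ⟨hge n, hn⟩, hn'⟩

/-- A drop of a right-continuous path by more than `b` is seen on dyadic time steps. -/
lemma exists_dyadic_dip {x : ℝ → ℝ} {q t b : ℝ} (hqt : q ≤ t)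
    (hx : ContinuousWithinAt x (Set.Ici t) t) (hb : x t - x q < -b) :
    ∃ m i : ℕ, x (q + (i : ℝ) / 2 ^ m) - x q < -b := by
  have hshift : ContinuousWithinAt (fun v => x (q + v)) (Set.Ici (t - q)) (t - q) := by
    rw [show t = q + (t - q) by ring] at hx
    refine hx.comp (by fun_prop) fun v hv => ?_
    simp only [Set.mem_Ici] at hv ⊢
    linarith
  obtain ⟨m, i, -, hi⟩ := (eventually_exists_dyadic_lt (c := x q - b) (sub_nonneg.2 hqt) hshift
    (by simp only [add_sub_cancel]; linarith) (lt_add_one _)).exists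
  exact ⟨m, i, by linarith⟩

/-- A càdlàg path that has no negative jumps and starts at `0` is at height at least
`-a` when it first enters `(-∞, -a)`; hence, if it reaches below `-a - b`, then on every fine
enough dyadic grid it still goes down by more than `b` after the first grid time at which it lies
below `-a`. -/
lemma eventually_dip_after_first_passage {x : ℝ → ℝ} (h0 : x 0 = 0)
    (hrc : ∀ t, 0 ≤ t → ContinuousWithinAt x (Set.Ici t) t)
    (hll : ∀ t, 0 < t → ∃ l, Tendsto x (nhdsWithin t (Set.Iio t)) (nhds l))
    (hnj : ∀ t, 0 < t → Function.leftLim x t ≤ x t) {a b t₀ : ℝ} (ha : 0 ≤ a) (hb : 0 ≤ b)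
    (ht₀ : 0 ≤ t₀) (hx : x t₀ < -(a + b)) :
    ∀ᶠ n : ℕ in atTop, ∃ k : ℕ,
      (x ((k : ℝ) / 2 ^ n) < -a ∧ ∀ j < k, -a ≤ x ((j : ℝ) / 2 ^ n)) ∧
      ∃ m i : ℕ, x ((k : ℝ) / 2 ^ n + (i : ℝ) / 2 ^ m) - x ((k : ℝ) / 2 ^ n) < -b := by
  classical
  set S : Set ℝ := {t | 0 ≤ t ∧ x t < -a} with hS
  have hSne : S.Nonempty := ⟨t₀, ht₀, by linarith⟩
  have hSbdd : BddBelow S := ⟨0, fun t ht => ht.1⟩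
  set T := sInf S with hT
  have hT0 : 0 ≤ T := le_csInf hSne fun t ht => ht.1
  have hTt : T ≤ t₀ := csInf_le hSbdd ⟨ht₀, by linarith⟩
  have hxT : -a ≤ x T := by
    rcases hT0.eq_or_lt with h | h
    · rw [← h, h0]
      linarith
    · obtain ⟨l, hl⟩ := hll T h
      have hle := hnj T h
      rw [leftLim_eq_of_tendsto hl] at hle
      refine le_trans (ge_of_tendsto hl ?_) hle
      filter_upwards [Ioo_mem_nhdsLT h] with s hs
      by_contra! hlt
      exact absurd (csInf_le hSbdd ⟨hs.1.le, hlt⟩) (not_le.2 hs.2)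
  have hTlt : T < t₀ := lt_of_le_of_ne hTt fun h => by
    rw [h] at hxT
    linarith
  have hev : ∀ᶠ s in nhdsWithin T (Set.Ici T), x t₀ + b < x s :=
    (hrc T hT0).tendsto.eventually_const_lt (by linarith)
  obtain ⟨u, hu, huT⟩ := (mem_nhdsGE_iff_exists_Ico_subset' hTlt).1 hev
  obtain ⟨t₁, ht₁, ht₁u⟩ := exists_lt_of_csInf_lt hSne (lt_min hu hTlt)
  filter_upwards [eventually_exists_dyadic_lt ht₁.1 (hrc t₁ ht₁.1) ht₁.2 ht₁u] with n hn
  obtain ⟨k', hk', hxk'⟩ := hn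
  have hex : ∃ k : ℕ, x ((k : ℝ) / 2 ^ n) < -a := ⟨k', hxk'⟩
  set k := Nat.find hex
  have hk : x ((k : ℝ) / 2 ^ n) < -a := Nat.find_spec hex
  have hkk' : (k : ℝ) / 2 ^ n ≤ (k' : ℝ) / 2 ^ n := by
    gcongr
    exact Nat.find_min' hex hxk'
  have hk0 : (0 : ℝ) ≤ (k : ℝ) / 2 ^ n := by positivity
  have hTk : T ≤ (k : ℝ) / 2 ^ n := csInf_le hSbdd ⟨hk0, hk⟩
  have hkmin : (k : ℝ) / 2 ^ n < min u t₀ := hkk'.trans_lt hk'.2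
  have hxk : x t₀ + b < x ((k : ℝ) / 2 ^ n) := huT ⟨hTk, hkmin.trans_le (min_le_left _ _)⟩
  refine ⟨k, ⟨hk, fun j hj => not_lt.1 (Nat.find_min hex hj)⟩, ?_⟩
  have hkt : (k : ℝ) / 2 ^ n ≤ t₀ := (hkmin.trans_le (min_le_right _ _)).le
  set q := (k : ℝ) / 2 ^ n
  exact exists_dyadic_dip hkt (hrc t₀ ht₀) (by linarith)

/-- A càdlàg path on `[0, ∞)` which tends to `+∞` is bounded below. -/
lemma bddBelow_image_Ici_of_cadlag {x : ℝ → ℝ}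
    (hrc : ∀ t, 0 ≤ t → ContinuousWithinAt x (Set.Ici t) t)
    (hll : ∀ t, 0 < t → ∃ l, Tendsto x (nhdsWithin t (Set.Iio t)) (nhds l))
    (hx : Tendsto x atTop atTop) : BddBelow (x '' Set.Ici 0) := by
  obtain ⟨K, hK⟩ := eventually_atTop.1 (hx.eventually_ge_atTop 0)
  have hcompact : BddBelow (x '' (Set.Icc 0 K)) := by
    refine isCompact_Icc.induction_on (p := fun s => BddBelow (x '' s)) (by simp)
      (fun s t hst ht => ht.mono (Set.image_mono hst))
      (fun s t hs ht => by rw [Set.image_union]; exact hs.union ht) fun t ht => ?_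
    have hright : ∀ᶠ s in nhdsWithin t (Set.Ici t), x t - 1 < x s :=
      (hrc t ht.1).tendsto.eventually_const_lt (by linarith)
    obtain ⟨c, hc⟩ : ∃ c, ∀ᶠ s in nhdsWithin t (Set.Icc 0 K ∩ Set.Iio t), c < x s := by
      rcases ht.1.eq_or_lt with h | h
      · refine ⟨0, ?_⟩
        have hempty : Set.Icc 0 K ∩ Set.Iio t = ∅ := by
          ext s
          simp only [← h, Set.mem_inter_iff, Set.mem_Icc, Set.mem_Iio, Set.mem_empty_iff_false,
            iff_false]
          intro hs
          linarith [hs.1.1, hs.2]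
        simp [hempty]
      · obtain ⟨l, hl⟩ := hll t h
        exact ⟨l - 1, (hl.eventually_const_lt (by linarith)).filter_mono
          (nhdsWithin_mono _ Set.inter_subset_right)⟩
    refine ⟨{s | min c (x t - 1) < x s}, ?_, min c (x t - 1), ?_⟩
    · have hsub : Set.Icc 0 K ⊆ (Set.Icc 0 K ∩ Set.Iio t) ∪ Set.Ici t := fun s hs => by
        rcases lt_or_ge s t with h | h
        · exact Or.inl ⟨hs, h⟩
        · exact Or.inr h
      refine nhdsWithin_mono t hsub ?_
      rw [nhdsWithin_union]
      exact ⟨hc.mono fun s hs => (min_le_left _ _).trans_lt hs,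
        hright.mono fun s hs => (min_le_right _ _).trans_lt hs⟩
    · rintro _ ⟨s, hs, rfl⟩
      exact le_of_lt hs
  refine (hcompact.union (bddBelow_Ici (a := (0 : ℝ)))).mono ?_
  rintro _ ⟨s, hs, rfl⟩
  rcases le_total s K with h | h
  · exact Or.inl ⟨s, ⟨hs, h⟩, rfl⟩
  · exact Or.inr (hK s h)

/-! ### The simple Markov property of a Lévy process on dyadic grids -/

/-- The σ-algebra generated by the process up to time `s`. -/
abbrev levyPast {Ω : Type*} (ξ : ℝ → Ω → ℝ) (s : ℝ) : MeasurableSpace Ω :=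
  ⨆ u ∈ Set.Icc (0 : ℝ) s, MeasurableSpace.comap (ξ u) inferInstance

/-- The event that, at some time in `s + {k / 2 ^ m}`, the process lies more than `b` below its
value at time `s`. -/
def dyadicDip {Ω : Type*} (ξ : ℝ → Ω → ℝ) (s b : ℝ) : Set Ω :=
  {ω | ∃ m k : ℕ, ξ (s + (k : ℝ) / 2 ^ m) ω - ξ s ω < -b}

/-- The event that `k / 2 ^ n` is the first time of the grid `{j / 2 ^ n}` at which the process
lies below `-a`. -/
def firstPassage {Ω : Type*} (ξ : ℝ → Ω → ℝ) (n : ℕ) (a : ℝ) (k : ℕ) : Set Ω :=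
  {ω | ξ ((k : ℝ) / 2 ^ n) ω < -a ∧ ∀ j < k, -a ≤ ξ ((j : ℝ) / 2 ^ n) ω}

section Past

variable {Ω : Type*} {ξ : ℝ → Ω → ℝ}

lemma levyPast_mono {s t : ℝ} (h : s ≤ t) : levyPast ξ s ≤ levyPast ξ t :=
  biSup_mono fun _ hu => ⟨hu.1, hu.2.trans h⟩

lemma measurable_levyPast {s u : ℝ} (hu : 0 ≤ u) (hus : u ≤ s) :
    Measurable[levyPast ξ s] (ξ u) :=
  (comap_measurable (ξ u)).mono
    (le_biSup (fun u => MeasurableSpace.comap (ξ u) inferInstance) ⟨hu, hus⟩) le_rfl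

lemma levyPast_le [MeasurableSpace Ω] (hm : ∀ t, Measurable (ξ t)) (s : ℝ) :
    levyPast ξ s ≤ ‹MeasurableSpace Ω› :=
  iSup₂_le fun u _ => (hm u).comap_le

lemma measurableSet_firstPassage (n : ℕ) (a : ℝ) (k : ℕ) :
    MeasurableSet[levyPast ξ ((k : ℝ) / 2 ^ n)] (firstPassage ξ n a k) := by
  have hm : ∀ j ≤ k, Measurable[levyPast ξ ((k : ℝ) / 2 ^ n)] (ξ ((j : ℝ) / 2 ^ n)) :=
    fun j hj => measurable_levyPast (by positivity) (by gcongr)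
  have heq : firstPassage ξ n a k = (ξ ((k : ℝ) / 2 ^ n)) ⁻¹' (Set.Iio (-a)) ∩
      ⋂ j ∈ Set.Iio k, (ξ ((j : ℝ) / 2 ^ n)) ⁻¹' (Set.Ici (-a)) := by
    ext ω
    simp [firstPassage]
  rw [heq]
  exact MeasurableSet.inter (hm k le_rfl measurableSet_Iio)
    (MeasurableSet.biInter (Set.to_countable _) fun j hj => hm j (le_of_lt hj) measurableSet_Ici)

lemma pairwise_disjoint_firstPassage (n : ℕ) (a : ℝ) :
    Pairwise (Function.onFun Disjoint (firstPassage ξ n a)) := by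
  have hlt : ∀ i j, i < j → Disjoint (firstPassage ξ n a i) (firstPassage ξ n a j) :=
    fun i j hij => Set.disjoint_left.2 fun ω hi hj => absurd hi.1 (not_lt.2 (hj.2 i hij))
  exact fun i j hij => hij.lt_or_gt.elim (hlt i j) fun h => (hlt j i h).symm

lemma iUnion_firstPassage (n : ℕ) (a : ℝ) :
    ⋃ k, firstPassage ξ n a k = {ω | ∃ k : ℕ, ξ ((k : ℝ) / 2 ^ n) ω < -a} := by
  classical
  ext ω
  simp only [firstPassage, Set.mem_iUnion, Set.mem_ofPred_eq]
  exact ⟨fun ⟨k, hk⟩ => ⟨k, hk.1⟩, fun h =>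
    ⟨Nat.find h, Nat.find_spec h, fun j hj => not_lt.1 (Nat.find_min h hj)⟩⟩

/-- `dyadicDip` as an increasing union of events depending on finitely many increments. -/
lemma dyadicDip_eq_iUnion (ξ : ℝ → Ω → ℝ) (s b : ℝ) :
    dyadicDip ξ s b =
      ⋃ m : ℕ, {ω | ∃ k : ℕ, k ≤ 4 ^ m ∧ ξ (s + (k : ℝ) / 2 ^ m) ω - ξ s ω < -b} := by
  ext ω
  simp only [dyadicDip, Set.mem_iUnion, Set.mem_ofPred_eq]
  refine ⟨fun ⟨m, k, h⟩ => ⟨m + k, k * 2 ^ k, ?_, ?_⟩, fun ⟨m, k, _, h⟩ => ⟨m, k, h⟩⟩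
  · calc k * 2 ^ k ≤ 2 ^ k * 2 ^ k := by gcongr; exact Nat.lt_two_pow_self.le
      _ = 4 ^ k := by rw [← mul_pow]; norm_num
      _ ≤ 4 ^ (m + k) := Nat.pow_le_pow_right (by norm_num) (by omega)
  · have hk : ((k * 2 ^ k : ℕ) : ℝ) / 2 ^ (m + k) = (k : ℝ) / 2 ^ m := by
      push_cast
      rw [pow_add]
      field_simp
    rwa [hk]

lemma monotone_dip_grid (ξ : ℝ → Ω → ℝ) (s b : ℝ) :
    Monotone fun m : ℕ => {ω | ∃ k : ℕ, k ≤ 4 ^ m ∧ ξ (s + (k : ℝ) / 2 ^ m) ω - ξ s ω < -b} := by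
  refine monotone_nat_of_le_succ fun m ω ⟨k, hk, h⟩ => ⟨2 * k, by rw [pow_succ]; omega, ?_⟩
  have hk' : ((2 * k : ℕ) : ℝ) / 2 ^ (m + 1) = (k : ℝ) / 2 ^ m := by
    push_cast
    rw [pow_succ]
    field_simp
  rwa [hk']

lemma measurableSet_dyadicDip [MeasurableSpace Ω] (hm : ∀ t, Measurable (ξ t)) (s b : ℝ) :
    MeasurableSet (dyadicDip ξ s b) := by
  have heq : dyadicDip ξ s b = ⋃ m : ℕ, ⋃ k : ℕ,
      {ω | ξ (s + (k : ℝ) / 2 ^ m) ω - ξ s ω < -b} := by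
    ext ω
    simp [dyadicDip]
  rw [heq]
  exact MeasurableSet.iUnion fun m => MeasurableSet.iUnion fun k =>
    measurableSet_lt ((hm _).sub (hm _)) measurable_const

end Past

section Increments

variable {Ω : Type*} [MeasurableSpace Ω] {P : Measure Ω} {ξ : ℝ → Ω → ℝ}

/-- The increments of a Lévy process along an arithmetic progression started at `s` are independent
of the past of `s` and of each other, with common law that of `ξ h`. -/
lemma IsLevyProcess.measure_inter_increments (hL : IsLevyProcess P ξ) {s h : ℝ} (hs : 0 ≤ s)
    (hh : 0 ≤ h) {A : Set Ω} (hA : MeasurableSet[levyPast ξ s] A) {S : ℕ → Set ℝ}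
    (hS : ∀ j, MeasurableSet (S j)) (N : ℕ) :
    P (A ∩ {ω | ∀ j < N, ξ (s + (j + 1) * h) ω - ξ (s + j * h) ω ∈ S j}) =
      P A * ∏ j ∈ Finset.range N, P.map (ξ h) (S j) := by
  obtain ⟨hm, -, -, -, hind, hstat⟩ := hL
  have hmeas : ∀ N : ℕ, MeasurableSet[levyPast ξ (s + N * h)]
      (A ∩ {ω | ∀ j < N, ξ (s + (j + 1) * h) ω - ξ (s + j * h) ω ∈ S j}) := fun N => by
    have heq : {ω | ∀ j < N, ξ (s + (j + 1) * h) ω - ξ (s + j * h) ω ∈ S j} =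
        ⋂ j ∈ Set.Iio N, (fun ω => ξ (s + (j + 1) * h) ω - ξ (s + j * h) ω) ⁻¹' S j := by
      ext ω
      simp
    rw [heq]
    refine MeasurableSet.inter (levyPast_mono (by nlinarith [N.cast_nonneg (α := ℝ)]) _ hA)
      (MeasurableSet.biInter (Set.to_countable _) fun j hj => ?_)
    have hjN : (j : ℝ) + 1 ≤ N := by exact_mod_cast hj
    refine Measurable.sub (measurable_levyPast (by positivity) (by gcongr))
      (measurable_levyPast (by positivity) ?_) (hS j)
    nlinarith
  induction N with
  | zero => simp
  | succ N ih =>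
    have hsplit : A ∩ {ω | ∀ j < N + 1, ξ (s + (j + 1) * h) ω - ξ (s + j * h) ω ∈ S j} =
        ((fun ω => ξ (s + (N + 1) * h) ω - ξ (s + N * h) ω) ⁻¹' S N) ∩
          (A ∩ {ω | ∀ j < N, ξ (s + (j + 1) * h) ω - ξ (s + j * h) ω ∈ S j}) := by
      ext ω
      simp only [Set.mem_inter_iff, Set.mem_ofPred_eq, Set.mem_preimage, Nat.lt_succ_iff_lt_or_eq]
      constructor
      · rintro ⟨h1, h2⟩
        exact ⟨h2 N (Or.inr rfl), h1, fun j hj => h2 j (Or.inl hj)⟩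
      · rintro ⟨h1, h2, h3⟩
        refine ⟨h2, ?_⟩
        rintro j (hj | rfl)
        · exact h3 j hj
        · exact h1
    have h1 : 0 ≤ s + N * h := by positivity
    have h2 : s + N * h ≤ s + (N + 1) * h := by linarith
    have hlast := (Measure.map_apply (μ := P)
      (show Measurable fun ω => ξ (s + (N + 1) * h) ω - ξ (s + N * h) ω from
        (hm _).sub (hm _)) (hS N)).symm
    rw [hsplit, (Indep_iff _ _ _).1 (hind _ _ h1 h2) _ _ ⟨S N, hS N, rfl⟩ (hmeas N), ih,
      Finset.prod_range_succ, hlast, hstat _ _ h1 h2,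
      show s + (N + 1) * h - (s + N * h) = h by ring, mul_comm, mul_assoc]

/-- The vector of increments after time `s` is independent of the past of `s`, and has the law of
the vector of increments after time `0`. -/
lemma IsLevyProcess.measure_inter_increments_mem [IsProbabilityMeasure P]
    (hL : IsLevyProcess P ξ) {s h : ℝ} (hs : 0 ≤ s) (hh : 0 ≤ h) {A : Set Ω}
    (hA : MeasurableSet[levyPast ξ s] A) (N : ℕ) {C : Set (Fin N → ℝ)} (hC : MeasurableSet C) :
    P (A ∩ {ω | (fun j : Fin N => ξ (s + (j + 1) * h) ω - ξ (s + j * h) ω) ∈ C}) =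
      P A * P {ω | (fun j : Fin N => ξ (0 + (j + 1) * h) ω - ξ (0 + j * h) ω) ∈ C} := by
  have hm := hL.1
  have hX : ∀ s : ℝ, Measurable
      fun ω => fun j : Fin N => ξ (s + (j + 1) * h) ω - ξ (s + j * h) ω :=
    fun s => measurable_pi_lambda _ fun j => (hm _).sub (hm _)
  suffices hlaw : (P.restrict A).map
        (fun ω => fun j : Fin N => ξ (s + (j + 1) * h) ω - ξ (s + j * h) ω) =
      P A • P.map (fun ω => fun j : Fin N => ξ (0 + (j + 1) * h) ω - ξ (0 + j * h) ω) by
    have := congrArg (fun μ : Measure (Fin N → ℝ) => μ C) hlaw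
    simp only [Measure.map_apply (hX s) hC, Measure.restrict_apply (hX s hC),
      Measure.smul_apply, Measure.map_apply (hX 0) hC, smul_eq_mul] at this
    rw [Set.inter_comm]
    exact this
  have hrect : ∀ S : Fin N → Set ℝ, (∀ j, MeasurableSet (S j)) → ∀ s : ℝ, 0 ≤ s → ∀ A : Set Ω,
      MeasurableSet[levyPast ξ s] A →
      P (A ∩ (fun ω => fun j : Fin N => ξ (s + (j + 1) * h) ω - ξ (s + j * h) ω) ⁻¹'
        (Set.univ.pi S)) = P A * ∏ j ∈ Finset.range N, P.map (ξ h)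
          (if hj : j < N then S ⟨j, hj⟩ else Set.univ) := by
    intro S hS s hs A hA
    rw [← hL.measure_inter_increments hs hh hA
      (S := fun j => if hj : j < N then S ⟨j, hj⟩ else Set.univ)]
    · congr 2
      ext ω
      simp only [Set.mem_preimage, Set.mem_univ_pi, Set.mem_ofPred_eq]
      refine ⟨fun hω j hj => ?_, fun hω j => ?_⟩
      · simpa [hj] using hω ⟨j, hj⟩
      · simpa using hω j j.2
    · intro j
      split_ifs
      exacts [hS _, MeasurableSet.univ]
  refine ext_of_generate_finite _ generateFrom_pi.symm isPiSystem_pi ?_ ?_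
  · rintro _ ⟨S, hS, rfl⟩
    have hS' : ∀ j, MeasurableSet (S j) := fun j => hS j (Set.mem_univ j)
    have hpi : MeasurableSet (Set.univ.pi S) := MeasurableSet.univ_pi hS'
    rw [Measure.map_apply (hX s) hpi, Measure.restrict_apply (hX s hpi), Measure.smul_apply,
      Measure.map_apply (hX 0) hpi, Set.inter_comm, hrect S hS' s hs A hA, smul_eq_mul,
      ← Set.univ_inter ((fun ω => fun j : Fin N =>
        ξ (0 + (j + 1) * h) ω - ξ (0 + j * h) ω) ⁻¹' _),
      hrect S hS' 0 le_rfl Set.univ MeasurableSet.univ, measure_univ, one_mul]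
  · rw [Measure.map_apply (hX s) MeasurableSet.univ, Measure.smul_apply,
      Measure.map_apply (hX 0) MeasurableSet.univ]
    simp

/-- The Markov property at time `s` for the event of going down by more than `b`. -/
lemma IsLevyProcess.measure_inter_dyadicDip [IsProbabilityMeasure P]
    (hL : IsLevyProcess P ξ) {s : ℝ} (hs : 0 ≤ s) (b : ℝ) {A : Set Ω}
    (hA : MeasurableSet[levyPast ξ s] A) :
    P (A ∩ dyadicDip ξ s b) = P A * P (dyadicDip ξ 0 b) := by
  have hgrid : ∀ m : ℕ,
      P (A ∩ {ω | ∃ k : ℕ, k ≤ 4 ^ m ∧ ξ (s + (k : ℝ) / 2 ^ m) ω - ξ s ω < -b}) =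
        P A * P {ω | ∃ k : ℕ, k ≤ 4 ^ m ∧ ξ (0 + (k : ℝ) / 2 ^ m) ω - ξ 0 ω < -b} := by
    intro m
    set C : Set (Fin (4 ^ m) → ℝ) :=
      {x | ∃ k : ℕ, k ≤ 4 ^ m ∧ ∑ j ∈ Finset.univ.filter (fun j : Fin (4 ^ m) => (j : ℕ) < k), x j < -b}
    have hC : MeasurableSet C := by
      have heq : C = ⋃ k ∈ Set.Iic (4 ^ m), {x : Fin (4 ^ m) → ℝ |
          ∑ j ∈ Finset.univ.filter (fun j : Fin (4 ^ m) => (j : ℕ) < k), x j < -b} := by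
        ext x
        simp [C]
      rw [heq]
      exact MeasurableSet.biUnion (Set.to_countable _) fun k _ =>
        measurableSet_lt (by fun_prop) measurable_const
    have hpath : ∀ s : ℝ, {ω | ∃ k : ℕ, k ≤ 4 ^ m ∧ ξ (s + (k : ℝ) / 2 ^ m) ω - ξ s ω < -b} =
        {ω | (fun j : Fin (4 ^ m) => ξ (s + (j + 1) * (1 / 2 ^ m)) ω -
          ξ (s + j * (1 / 2 ^ m)) ω) ∈ C} := by
      intro s
      ext ω
      simp only [C, Set.mem_ofPred_eq]
      refine exists_congr fun k => and_congr_right fun hk => ?_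
      have hsum : ∑ j ∈ Finset.univ.filter (fun j : Fin (4 ^ m) => (j : ℕ) < k),
          (ξ (s + (j + 1) * (1 / 2 ^ m)) ω - ξ (s + j * (1 / 2 ^ m)) ω) =
          ∑ j ∈ Finset.range k,
            (ξ (s + ((j + 1 : ℕ) : ℝ) * (1 / 2 ^ m)) ω - ξ (s + (j : ℝ) * (1 / 2 ^ m)) ω) := by
        refine Finset.sum_bij (fun j _ => (j : ℕ)) (fun j hj => by simpa using hj)
          (fun i _ j _ hij => Fin.ext hij)
          (fun j hj => ⟨⟨j, (Finset.mem_range.1 hj).trans_le hk⟩, by simpa using hj, rfl⟩)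
          (fun j _ => by push_cast; rfl)
      rw [hsum, Finset.sum_range_sub (fun j : ℕ => ξ (s + (j : ℝ) * (1 / 2 ^ m)) ω)]
      simp [div_eq_mul_inv]
    rw [hpath, hpath]
    exact hL.measure_inter_increments_mem hs (by positivity) hA _ hC
  rw [dyadicDip_eq_iUnion, dyadicDip_eq_iUnion, Set.inter_iUnion,
    (monotone_dip_grid ξ 0 b).measure_iUnion, ENNReal.mul_iSup, Monotone.measure_iUnion]
  · exact iSup_congr hgrid
  · exact fun i j hij => Set.inter_subset_inter_right _ (monotone_dip_grid ξ s b hij)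

end Increments

/-! ### The law of the overall infimum -/

/-- The exponentials are the only nonincreasing multiplicative functions on `[0, ∞)` which are
neither constant nor zero on `(0, ∞)`. -/
lemma exists_eq_exp_neg_mul_of_map_add {f : ℝ → ℝ}
    (hmul : ∀ a b, 0 ≤ a → 0 ≤ b → f (a + b) = f a * f b)
    (hanti : ∀ a b, 0 ≤ a → a ≤ b → f b ≤ f a)
    (hpos : ∃ c, 0 < c ∧ 0 < f c) (hlt : ∃ c, 0 ≤ c ∧ f c < 1) :
    ∃ γ, 0 < γ ∧ ∀ c, 0 ≤ c → f c = Real.exp (-(γ * c)) := by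
  obtain ⟨c₀, hc₀, hfc₀⟩ := hpos
  have hf0 : f 0 = 1 := by
    have := hmul 0 c₀ le_rfl hc₀.le
    rw [zero_add] at this
    exact (mul_eq_right₀ hfc₀.ne').1 this.symm
  have hpow : ∀ c, 0 ≤ c → ∀ n : ℕ, f (n * c) = f c ^ n := by
    intro c hc n
    induction n with
    | zero => simp [hf0]
    | succ n ih =>
      rw [pow_succ, ← ih, ← hmul _ _ (by positivity) hc]
      push_cast
      ring_nf
  have hfpos : ∀ c, 0 ≤ c → 0 < f c := by
    intro c hc
    obtain ⟨n, hn⟩ := exists_nat_ge (c / c₀)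
    have hle := hanti c (n * c₀) hc ((div_le_iff₀ hc₀).1 hn)
    rw [hpow _ hc₀.le] at hle
    exact (pow_pos hfc₀ n).trans_le hle
  set g : ℝ → ℝ := fun c => -Real.log (f c) with hg
  have hgmul : ∀ c, 0 ≤ c → ∀ n : ℕ, g (n * c) = n * g c := fun c hc n => by
    simp [hg, hpow c hc]
  have hgmono : ∀ a b, 0 ≤ a → a ≤ b → g a ≤ g b := fun a b ha hab =>
    neg_le_neg (Real.log_le_log (hfpos b (ha.trans hab)) (hanti a b ha hab))
  have hglin : ∀ c, 0 ≤ c → g c = g 1 * c := by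
    intro c hc
    have hbound : ∀ n : ℕ, |g c - g 1 * c| * n ≤ g 1 := by
      intro n
      have hnc : 0 ≤ (n : ℝ) * c := by positivity
      have h1 := hgmono _ _ (Nat.cast_nonneg _) (Nat.floor_le hnc)
      have h2 := hgmono _ _ hnc (Nat.lt_floor_add_one ((n : ℝ) * c)).le
      have hint : ∀ k : ℕ, g k = k * g 1 := fun k => by simpa using hgmul 1 zero_le_one k
      have hint' := hint (⌊(n : ℝ) * c⌋₊ + 1)
      push_cast at hint'
      rw [hint'] at h2
      rw [hint] at h1
      rw [hgmul c hc] at h1 h2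
      have hg1 : 0 ≤ g 1 := by
        have := hgmono 0 1 le_rfl zero_le_one
        simpa [hg, hf0] using this
      have h3 := mul_le_mul_of_nonneg_right (Nat.floor_le hnc) hg1
      have h4 := mul_le_mul_of_nonneg_right (Nat.lt_floor_add_one ((n : ℝ) * c)).le hg1
      rw [← abs_of_nonneg (Nat.cast_nonneg (α := ℝ) n), ← abs_mul, abs_le]
      constructor <;> nlinarith
    by_contra hne
    have hd : 0 < |g c - g 1 * c| := abs_pos.2 (sub_ne_zero.2 hne)
    obtain ⟨n, hn⟩ := exists_nat_gt (g 1 / |g c - g 1 * c|)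
    rw [div_lt_iff₀ hd] at hn
    linarith [hbound n]
  have hfexp : ∀ c, 0 ≤ c → f c = Real.exp (-(g 1 * c)) := fun c hc => by
    rw [← hglin c hc, hg]
    simp [Real.exp_log (hfpos c hc)]
  obtain ⟨c₁, hc₁, hfc₁⟩ := hlt
  refine ⟨g 1, ?_, hfexp⟩
  rw [hfexp c₁ hc₁, Real.exp_lt_one_iff, neg_lt_zero] at hfc₁
  exact pos_of_mul_pos_left hfc₁ hc₁

section Infimum

variable {Ω : Type*} {ξ : ℝ → Ω → ℝ}

lemma mem_dyadicDip_zero_iff {ω : Ω} {b : ℝ} (h0 : ξ 0 ω = 0)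
    (hrc : ∀ t, 0 ≤ t → ContinuousWithinAt (fun s => ξ s ω) (Set.Ici t) t) :
    ω ∈ dyadicDip ξ 0 b ↔ ∃ t, 0 ≤ t ∧ ξ t ω < -b := by
  constructor
  · rintro ⟨m, k, h⟩
    rw [h0, sub_zero] at h
    exact ⟨_, by positivity, h⟩
  · rintro ⟨t, ht, h⟩
    exact exists_dyadic_dip (x := fun s => ξ s ω) ht (hrc t ht) (by simpa [h0] using h)

variable [MeasurableSpace Ω] {P : Measure Ω} [IsProbabilityMeasure P]

/-- The process goes down by more than `a + b` with the product of the probabilities that it goes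
down by more than `a` and by more than `b`: at the first passage below `-a`, the process without
negative jumps starts afresh from `-a`. -/
lemma IsLevyProcess.measure_dyadicDip_add (hL : IsLevyProcess P ξ)
    (hnj : ∀ᵐ ω ∂P, ∀ t : ℝ, 0 < t → Function.leftLim (fun s => ξ s ω) t ≤ ξ t ω)
    {a b : ℝ} (ha : 0 ≤ a) (hb : 0 ≤ b) :
    P (dyadicDip ξ 0 (a + b)) = P (dyadicDip ξ 0 a) * P (dyadicDip ξ 0 b) := by
  obtain ⟨hm, h0, hrc, hll, -, -⟩ := id hL
  set H : ℕ → Set Ω := fun n =>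
    ⋃ k : ℕ, firstPassage ξ n a k ∩ dyadicDip ξ ((k : ℝ) / 2 ^ n) b
  set E : ℕ → Set Ω := fun n => {ω | ∃ k : ℕ, ξ ((k : ℝ) / 2 ^ n) ω < -a}
  have hfp : ∀ n k, MeasurableSet (firstPassage ξ n a k) := fun n k =>
    levyPast_le hm _ _ (measurableSet_firstPassage n a k)
  have hH : ∀ n, P (H n) = P (E n) * P (dyadicDip ξ 0 b) := by
    intro n
    simp only [H, E]
    rw [measure_iUnion, ← iUnion_firstPassage, measure_iUnion, ← ENNReal.tsum_mul_right]
    · exact tsum_congr fun k =>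
        hL.measure_inter_dyadicDip (by positivity) b (measurableSet_firstPassage n a k)
    · exact pairwise_disjoint_firstPassage n a
    · exact hfp n
    · exact fun i j hij => (pairwise_disjoint_firstPassage n a hij).mono
        Set.inter_subset_left Set.inter_subset_left
    · exact fun k => (hfp n k).inter (measurableSet_dyadicDip hm _ _)
  have hEle : ∀ n, P (E n) ≤ P (dyadicDip ξ 0 a) := by
    intro n
    refine measure_mono_ae ?_
    filter_upwards [h0, hrc] with ω h0 hrc
    rintro ⟨k, hk⟩
    exact (mem_dyadicDip_zero_iff h0 hrc).2 ⟨_, by positivity, hk⟩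
  have hHle : ∀ n, P (H n) ≤ P (dyadicDip ξ 0 (a + b)) := by
    intro n
    refine measure_mono_ae ?_
    filter_upwards [h0, hrc] with ω h0 hrc
    intro hω
    obtain ⟨k, hk, m, i, hi⟩ := Set.mem_iUnion.1 hω
    exact (mem_dyadicDip_zero_iff h0 hrc).2
      ⟨(k : ℝ) / 2 ^ n + (i : ℝ) / 2 ^ m, by positivity, by linarith [hk.1]⟩
  apply le_antisymm
  · have hsub : P (dyadicDip ξ 0 (a + b)) ≤ P (⋃ N : ℕ, ⋂ n ≥ N, H n) := by
      refine measure_mono_ae ?_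
      filter_upwards [h0, hrc, hll, hnj] with ω h0 hrc hll hnj
      intro hω
      obtain ⟨t, ht, hlt⟩ := (mem_dyadicDip_zero_iff h0 hrc).1 hω
      obtain ⟨N, hN⟩ := eventually_atTop.1
        (eventually_dip_after_first_passage h0 hrc hll hnj ha hb ht hlt)
      refine Set.mem_iUnion.2 ⟨N, Set.mem_iInter₂.2 fun n hn => ?_⟩
      obtain ⟨k, hk, hdip⟩ := hN n hn
      exact Set.mem_iUnion.2 ⟨k, hk, hdip⟩
    refine hsub.trans ?_
    rw [Monotone.measure_iUnion]
    · refine iSup_le fun N => (measure_mono (Set.iInter₂_subset N le_rfl)).trans ?_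
      rw [hH]
      exact mul_le_mul' (hEle N) le_rfl
    · exact fun i j hij => Set.biInter_mono (fun n hn => le_trans hij hn) fun _ _ => subset_rfl
  · have hmono : Monotone E := by
      refine monotone_nat_of_le_succ fun n ω ⟨k, hk⟩ => ⟨2 * k, ?_⟩
      have hk' : ((2 * k : ℕ) : ℝ) / 2 ^ (n + 1) = (k : ℝ) / 2 ^ n := by
        push_cast
        rw [pow_succ]
        field_simp
      rwa [hk']
    have hsub : P (dyadicDip ξ 0 a) ≤ P (⋃ n, E n) := by
      refine measure_mono_ae ?_
      filter_upwards [h0] with ω h0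
      rintro ⟨m, k, h⟩
      exact Set.mem_iUnion.2 ⟨m, k, by simpa [h0] using h⟩
    calc P (dyadicDip ξ 0 a) * P (dyadicDip ξ 0 b)
        ≤ P (⋃ n, E n) * P (dyadicDip ξ 0 b) := by gcongr
      _ = ⨆ n, P (H n) := by
        rw [hmono.measure_iUnion, ENNReal.iSup_mul]
        exact iSup_congr fun n => (hH n).symm
      _ ≤ P (dyadicDip ξ 0 (a + b)) := iSup_le hHle

/-- A Lévy process that a.s. never goes below its starting point is a.s. nondecreasing. -/
lemma IsLevyProcess.ae_monotoneOn_of_measure_dyadicDip_eq_zero (hL : IsLevyProcess P ξ)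
    (hz : P (dyadicDip ξ 0 0) = 0) :
    ∀ᵐ ω ∂P, MonotoneOn (fun t => ξ t ω) (Set.Ici 0) := by
  have hnull : ∀ᵐ ω ∂P, ∀ n k : ℕ, ω ∉ dyadicDip ξ ((k : ℝ) / 2 ^ n) 0 := by
    refine ae_all_iff.2 fun n => ae_all_iff.2 fun k => ?_
    have := hL.measure_inter_dyadicDip (s := (k : ℝ) / 2 ^ n) (by positivity) 0 MeasurableSet.univ
    rw [hz, mul_zero, Set.univ_inter] at this
    exact measure_eq_zero_iff_ae_notMem.1 this
  filter_upwards [hnull, hL.2.2.1] with ω hω hrc s hs t ht hst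
  by_contra! hlt
  have hne : s < t := lt_of_le_of_ne hst fun h => by simp [h] at hlt
  obtain ⟨n, k, hk, hxk⟩ := (eventually_exists_dyadic_lt (x := fun u => -ξ u ω)
    (c := -ξ t ω) hs (hrc s hs).neg (neg_lt_neg hlt) hne).exists
  exact hω n k (exists_dyadic_dip (x := fun u => ξ u ω) hk.2.le (hrc t ht) (by linarith))

/-- For a Lévy process with no negative jumps, which is not a.s. nondecreasing and is a.s. bounded
below, the overall infimum has exponential tails. -/
lemma IsLevyProcess.exists_measureReal_dyadicDip_eq_exp (hL : IsLevyProcess P ξ)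
    (hnj : ∀ᵐ ω ∂P, ∀ t : ℝ, 0 < t → Function.leftLim (fun s => ξ s ω) t ≤ ξ t ω)
    (hbdd : ∀ᵐ ω ∂P, BddBelow ((fun t => ξ t ω) '' Set.Ici 0))
    (hmono : ¬ ∀ᵐ ω ∂P, MonotoneOn (fun t => ξ t ω) (Set.Ici 0)) :
    ∃ γ : ℝ, 0 < γ ∧ ∀ c : ℝ, 0 ≤ c → P.real (dyadicDip ξ 0 c) = Real.exp (-(γ * c)) := by
  have hanti : ∀ a b : ℝ, a ≤ b → dyadicDip ξ 0 b ⊆ dyadicDip ξ 0 a :=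
    fun a b hab ω ⟨m, k, h⟩ => ⟨m, k, by linarith⟩
  apply exists_eq_exp_neg_mul_of_map_add
  · intro a b ha hb
    simp only [measureReal_def, hL.measure_dyadicDip_add hnj ha hb, ENNReal.toReal_mul]
  · exact fun a b _ hab => measureReal_mono (hanti a b hab)
  · have hunion : dyadicDip ξ 0 0 = ⋃ n : ℕ, dyadicDip ξ 0 (1 / ((n : ℝ) + 1)) := by
      refine Set.Subset.antisymm (fun ω ⟨m, k, h⟩ => ?_)
        (Set.iUnion_subset fun n => hanti _ _ (by positivity))
      rw [neg_zero] at h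
      obtain ⟨n, hn⟩ := exists_nat_one_div_lt (neg_pos.2 h)
      exact Set.mem_iUnion.2 ⟨n, m, k, by linarith⟩
    have hne : P (⋃ n : ℕ, dyadicDip ξ 0 (1 / ((n : ℝ) + 1))) ≠ 0 := fun h =>
      hmono (hL.ae_monotoneOn_of_measure_dyadicDip_eq_zero (hunion ▸ h))
    rw [Ne, measure_iUnion_null_iff, not_forall] at hne
    obtain ⟨n, hn⟩ := hne
    exact ⟨_, Nat.one_div_pos_of_nat, ENNReal.toReal_pos hn (measure_ne_top _ _)⟩
  · by_contra! hge
    have hone : ∀ n : ℕ, ∀ᵐ ω ∂P, ω ∈ dyadicDip ξ 0 n := fun n =>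
      (mem_ae_iff_prob_eq_one (measurableSet_dyadicDip hL.1 _ _)).2 <| by
        refine le_antisymm prob_le_one ?_
        have := hge n n.cast_nonneg
        rw [measureReal_def] at this
        rw [← ENNReal.ofReal_toReal (measure_ne_top P (dyadicDip ξ 0 n))]
        exact ENNReal.one_le_ofReal.2 this
    have hfalse : ∀ᵐ _ ∂P, False := by
      filter_upwards [ae_all_iff.2 hone, hL.2.1, hL.2.2.1, hbdd] with ω hω h0 hrc ⟨B, hB⟩
      obtain ⟨n, hn⟩ := exists_nat_ge (-B)
      obtain ⟨t, ht, hlt⟩ := (mem_dyadicDip_zero_iff h0 hrc).1 (hω n)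
      have := hB ⟨t, ht, rfl⟩
      dsimp only at this
      linarith
    exact (hfalse.exists).elim fun _ h => h

end Infimum

/-- Proposition 3, law of the infimum. Let `ξ` be a Lévy process with
no negative jumps, drifting to `+∞`, whose paths are not a.s. nondecreasing, and let
`I = inf_{t ≥ 0} ξ_t`. Then there is `γ > 0` such that for all `x > 0` and `ε ≥ 0`,
`P(x e^I ≤ ε) = min((ε/x)^γ, 1)`, i.e. `-I` is exponential of parameter `γ`. -/
theorem infimum_exponential_law_no_negative_jumps
    {Ω : Type*} [MeasurableSpace Ω] (P : Measure Ω) [IsProbabilityMeasure P]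
    (ξ : ℝ → Ω → ℝ) (hLevy : IsLevyProcess P ξ)
    (hNoNegJumps : ∀ᵐ ω ∂P, ∀ t : ℝ, 0 < t → Function.leftLim (fun s => ξ s ω) t ≤ ξ t ω)
    (hDrift : ∀ᵐ ω ∂P, Tendsto (fun t => ξ t ω) atTop atTop)
    (hNotMono : ¬ (∀ᵐ ω ∂P, MonotoneOn (fun t => ξ t ω) (Set.Ici 0)))
    (I : Ω → ℝ) (hI : ∀ ω, I ω = sInf ((fun t => ξ t ω) '' Set.Ici 0)) :
    ∃ γ : ℝ, 0 < γ ∧ ∀ x : ℝ, 0 < x → ∀ ε : ℝ, 0 ≤ ε →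
      (P {ω | x * Real.exp (I ω) ≤ ε}).toReal = min ((ε / x) ^ γ) 1 := by
  obtain ⟨-, h0, hrc, hll, -, -⟩ := id hLevy
  have hbdd : ∀ᵐ ω ∂P, BddBelow ((fun t => ξ t ω) '' Set.Ici 0) := by
    filter_upwards [hrc, hll, hDrift] with ω hrc hll hDrift
    exact bddBelow_image_Ici_of_cadlag hrc hll hDrift
  obtain ⟨γ, hγ, hlaw⟩ :=
    hLevy.exists_measureReal_dyadicDip_eq_exp hNoNegJumps hbdd hNotMono
  refine ⟨γ, hγ, fun x hx ε hε => ?_⟩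
  rcases hε.eq_or_lt with rfl | hε
  · have hempty : {ω | x * Real.exp (I ω) ≤ 0} = ∅ :=
      Set.eq_empty_of_forall_notMem fun ω hω => (mul_pos hx (Real.exp_pos (I ω))).not_ge hω
    simp [hempty, Real.zero_rpow hγ.ne']
  have hratio : 0 < ε / x := div_pos hε hx
  have hset : {ω | x * Real.exp (I ω) ≤ ε} = {ω | I ω ≤ Real.log (ε / x)} := by
    ext ω
    simp only [Set.mem_ofPred_eq]
    rw [Real.le_log_iff_exp_le hratio, le_div_iff₀ hx, mul_comm]
  rw [hset, Real.rpow_def_of_pos hratio]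
  set L := Real.log (ε / x)
  rcases le_or_gt 0 L with hL | hL
  · rw [min_eq_right (Real.one_le_exp (by positivity))]
    have hae : {ω | I ω ≤ L} =ᵐ[P] Set.univ := by
      refine eventuallyEq_univ.2 ?_
      filter_upwards [h0, hbdd] with ω h0 hbdd
      have hle := csInf_le hbdd ⟨0, Set.self_mem_Ici, rfl⟩
      rw [← hI] at hle
      dsimp only at hle
      rw [h0] at hle
      exact hle.trans hL
    rw [measure_congr hae]
    simp
  · rw [min_eq_left (Real.exp_le_one_iff.2 (mul_nonpos_of_nonpos_of_nonneg hL.le hγ.le))]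
    apply le_antisymm
    · have hlim : Tendsto (fun c : ℝ => Real.exp (-(γ * c))) (nhdsWithin (-L) (Set.Iio (-L)))
          (nhds (Real.exp (L * γ))) := by
        have hcont : Continuous fun c : ℝ => Real.exp (-(γ * c)) := by fun_prop
        have := (hcont.tendsto (-L)).mono_left (nhdsWithin_le_nhds (s := Set.Iio (-L)))
        rwa [show -(γ * -L) = L * γ by ring] at this
      refine ge_of_tendsto hlim ?_
      filter_upwards [Ioo_mem_nhdsLT (neg_pos.2 hL)] with c hc
      rw [← hlaw c hc.1.le]
      refine ENNReal.toReal_mono (measure_ne_top _ _) (measure_mono_ae ?_)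
      filter_upwards [h0, hrc] with ω h0 hrc
      intro (hω : I ω ≤ L)
      rw [hI] at hω
      obtain ⟨_, ⟨t, ht, rfl⟩, hlt⟩ := exists_lt_of_csInf_lt
        (Set.Nonempty.image _ Set.nonempty_Ici) (hω.trans_lt (lt_neg_of_lt_neg hc.2))
      exact (mem_dyadicDip_zero_iff h0 hrc).2 ⟨t, ht, hlt⟩
    · have hdip := hlaw (-L) (neg_nonneg.2 hL.le)
      rw [show L * γ = -(γ * -L) by ring, ← hdip]
      refine ENNReal.toReal_mono (measure_ne_top _ _) (measure_mono_ae ?_)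
      filter_upwards [h0, hrc, hbdd] with ω h0 hrc hbdd
      intro hω
      obtain ⟨t, ht, hlt⟩ := (mem_dyadicDip_zero_iff h0 hrc).1 hω
      have hle := csInf_le hbdd ⟨t, ht, rfl⟩
      rw [← hI] at hle
      change I ω ≤ L
      linarith

end
end

section
/- Let ξ = (ξ_t)_{t≥0} be a real-valued Lévy process with infinite lifetime which drifts to +∞ (lim_{t→∞} ξ_t = +∞ a.s.), and let I = inf_{t≥0} ξ_t. Assume P(−I > u) > 0 for every u ≥ 0, and that for every x > 0 the limit h(x) := lim_{ε→0+} P( x e^{I} < ε ) / P( e^{I} < ε ) exists in (0, ∞) and that h is not constant. Then there exists γ > 0 such that h(x) = x^{−γ} for all x > 0, and moreover lim_{u→∞} P(−I > u − z)/P(−I > u) = e^{γz} for every z ∈ ℝ (i.e. the law of −I belongs to the class 𝓛^γ). -/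
open MeasureTheory ProbabilityTheory Filter Set Topology ENNReal

noncomputable section

/-- An additive antitone function on `ℝ` is multiplication by a nonpositive constant. -/
lemma exists_eq_neg_mul_of_additive_of_antitone (f : ℝ → ℝ)
    (hadd : ∀ x y, f (x + y) = f x + f y) (hf : Antitone f) :
    ∃ γ : ℝ, 0 ≤ γ ∧ ∀ x, f x = -(γ * x) := by
  let F : ℝ →+ ℝ := AddMonoidHom.mk' f hadd
  have hF : Continuous F := MeasureTheory.Measure.AddMonoidHom.continuous_of_measurable F hf.measurable
  have h0 : f 0 = 0 := F.map_zero
  refine ⟨-f 1, by linarith [hf zero_le_one], fun x => ?_⟩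
  have hx : f (x • (1 : ℝ)) = x • f 1 := map_real_smul F hF x 1
  simp only [smul_eq_mul, mul_one] at hx
  rw [hx]
  ring

/-- If the ratios `G (u + z) / G u` of a positive antitone function `G` converge at infinity
to positive limits, then the limits are exponential in `z`. -/
lemma exists_limit_eq_exp_of_antitone (G g : ℝ → ℝ) (hG : Antitone G) (hGpos : ∀ u, 0 < G u)
    (hlim : ∀ z, Tendsto (fun u => G (u + z) / G u) atTop (𝓝 (g z))) (hg : ∀ z, 0 < g z) :
    ∃ γ : ℝ, 0 ≤ γ ∧ ∀ z, g z = Real.exp (-(γ * z)) := by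
  have hmul : ∀ x y, g (x + y) = g x * g y := fun x y => by
    have h1 := ((hlim y).comp (tendsto_atTop_add_const_right atTop x tendsto_id)).mul (hlim x)
    have h2 := tendsto_nhds_unique (hlim (x + y)) (h1.congr fun u => ?_)
    · rw [h2, mul_comm]
    · simp only [Function.comp_apply, id_eq]
      rw [div_mul_div_cancel₀ (hGpos _).ne', add_assoc]
  have hanti : Antitone g := fun x y hxy =>
    le_of_tendsto_of_tendsto' (hlim y) (hlim x) fun u =>
      div_le_div_of_nonneg_right (hG (by linarith)) (hGpos u).le
  obtain ⟨γ, hγ, h⟩ := exists_eq_neg_mul_of_additive_of_antitone (fun z => Real.log (g z))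
    (fun x y => by rw [hmul, Real.log_mul (hg x).ne' (hg y).ne'])
    (fun x y hxy => Real.log_le_log (hg y) (hanti hxy))
  exact ⟨γ, hγ, fun z => by rw [← h z, Real.exp_log (hg z)]⟩

/-- hypothesis (H') and the class `𝓛^γ`. Let `ξ` be a Lévy process
drifting to `+∞` and `I = inf_{t ≥ 0} ξ_t`. Assume `P(-I > u) > 0` for every `u ≥ 0`, that
for every `x > 0` the limit `h(x) = lim_{ε→0+} P(x e^I < ε)/P(e^I < ε)` exists in `(0,∞)`,
and that `h` is not constant on `(0,∞)`. Then there is `γ > 0` with `h(x) = x^{-γ}` for all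
`x > 0`, and `P(-I > u - z)/P(-I > u) → e^{γz}` as `u → ∞`, for every `z ∈ ℝ`. -/
theorem hypothesis_Hprime_power_form
    {Ω : Type*} [MeasurableSpace Ω] (P : Measure Ω) [IsProbabilityMeasure P]
    (ξ : ℝ → Ω → ℝ) (hLevy : IsLevyProcess P ξ)
    (hDrift : ∀ᵐ ω ∂P, Tendsto (fun t => ξ t ω) atTop atTop)
    (I : Ω → ℝ) (hI : ∀ ω, I ω = sInf ((fun t => ξ t ω) '' Set.Ici 0))
    (hIpos : ∀ u : ℝ, 0 ≤ u → 0 < P {ω | -I ω > u})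
    (h : ℝ → ℝ)
    (hlim : ∀ x : ℝ, 0 < x →
      Tendsto (fun ε => (P {ω | x * Real.exp (I ω) < ε}).toReal /
          (P {ω | Real.exp (I ω) < ε}).toReal)
        (𝓝[>] (0:ℝ)) (𝓝 (h x)))
    (hpos : ∀ x : ℝ, 0 < x → 0 < h x)
    (hNotConst : ¬ ∃ c : ℝ, ∀ x : ℝ, 0 < x → h x = c) :
    ∃ γ : ℝ, 0 < γ ∧ (∀ x : ℝ, 0 < x → h x = x ^ (-γ)) ∧
      ∀ z : ℝ, Tendsto
        (fun u => (P {ω | -I ω > u - z}).toReal / (P {ω | -I ω > u}).toReal)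
        atTop (𝓝 (Real.exp (γ * z))) := by
  set G : ℝ → ℝ := fun u => (P {ω | -I ω > u}).toReal with hGdef
  have hG : Antitone G := fun u v huv =>
    ENNReal.toReal_mono (measure_ne_top _ _)
      (measure_mono fun ω (hω : -I ω > v) => lt_of_le_of_lt huv hω)
  have hGpos : ∀ u, 0 < G u := fun u =>
    lt_of_lt_of_le (ENNReal.toReal_pos (hIpos _ (le_max_right u 0)).ne' (measure_ne_top _ _))
      (hG (le_max_left u 0))
  have hset : ∀ z u, {ω | Real.exp z * Real.exp (I ω) < Real.exp (-u)} =
      {ω | -I ω > u + z} := fun z u => by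
    ext ω
    simp only [mem_ofPred_eq, ← Real.exp_add, Real.exp_lt_exp]
    constructor <;> intro hω <;> linarith
  have hexp : Tendsto (fun u : ℝ => Real.exp (-u)) atTop (𝓝[>] 0) :=
    tendsto_nhdsWithin_iff.2 ⟨Real.tendsto_exp_neg_atTop_nhds_zero,
      Eventually.of_forall fun u => Real.exp_pos _⟩
  have hratio : ∀ z, Tendsto (fun u => G (u + z) / G u) atTop (𝓝 (h (Real.exp z))) :=
    fun z => ((hlim _ (Real.exp_pos z)).comp hexp).congr fun u => by
      have h0 := hset 0 u
      simp only [Real.exp_zero, one_mul, add_zero] at h0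
      simp only [Function.comp_apply, hset, h0, hGdef]
  obtain ⟨γ, hγ, hform⟩ := exists_limit_eq_exp_of_antitone G (fun z => h (Real.exp z)) hG hGpos
    hratio fun z => hpos _ (Real.exp_pos z)
  have hpow : ∀ x : ℝ, 0 < x → h x = x ^ (-γ) := fun x hx => by
    have hx' := hform (Real.log x)
    simp only [Real.exp_log hx] at hx'
    rw [hx', Real.rpow_def_of_pos hx]
    congr 1
    ring
  refine ⟨γ, lt_of_le_of_ne hγ fun h0 => hNotConst ⟨1, fun x hx => ?_⟩, hpow, fun z => ?_⟩
  · rw [hpow x hx, ← h0, neg_zero, Real.rpow_zero]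
  · have hz := hratio (-z)
    simp only [hform, mul_neg, neg_neg] at hz
    exact hz

end
end

section
/- Let f : [0,∞) → ℝ be measurable with s ↦ e^{f(s)} locally integrable and ∫_0^∞ e^{f(u)} du = ∞. Fix x > 0, ρ ≥ 0 and ι ∈ ℝ; define A(s) = ∫_0^s e^{f(u)} du, τ(t) = inf{s ≥ 0 : A(s) > t}, m = x A(ρ), g(u) = f(ρ + u) − ι, I = x e^{ι}, and τ̲(r) = inf{s ≥ 0 : ∫_0^s e^{g(u)} du > r}. Then for every t ≥ 0, x exp( f( τ( (m + t)/x ) ) ) = I exp( g( τ̲( t/I ) ) ). -/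
open MeasureTheory Filter Set Topology ENNReal

noncomputable section

/-- If `h` is nonnegative, locally integrable on `[0, ∞)` and has infinite integral there, then its
primitive is unbounded. -/
theorem exists_lt_intervalIntegral_of_lintegral_eq_top {h : ℝ → ℝ} (hnonneg : ∀ u, 0 ≤ h u)
    (hloc : ∀ s : ℝ, IntegrableOn h (Set.Icc 0 s))
    (hinfty : ∫⁻ u in Set.Ioi (0:ℝ), ENNReal.ofReal (h u) = ⊤) (c : ℝ) :
    ∃ s : ℝ, 0 ≤ s ∧ c < ∫ u in (0:ℝ)..s, h u := by
  by_contra! hbound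
  have hint : IntegrableOn h (Set.Ioi 0) := by
    refine integrableOn_Ioi_of_intervalIntegral_norm_bounded (l := atTop) (b := id) c 0
      (fun s => (hloc s).mono_set Set.Ioc_subset_Icc_self) tendsto_id ?_
    filter_upwards [eventually_ge_atTop (0:ℝ)] with s hs
    simpa only [Real.norm_of_nonneg (hnonneg _), id] using hbound s hs
  have hfin := hint.hasFiniteIntegral
  rw [hasFiniteIntegral_iff_ofReal (ae_of_all _ hnonneg), hinfty] at hfin
  exact lt_irrefl _ hfin

/-- Translation commutes with the infimum of a nonempty set of reals that is bounded below. -/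
theorem csInf_image_const_add (a : ℝ) {S : Set ℝ} (hne : S.Nonempty) (hbdd : BddBelow S) :
    sInf ((fun s => a + s) '' S) = a + sInf S :=
  ((OrderIso.addLeft a).map_csInf' hne hbdd).symm

/-- deterministic identity behind the post-minimum representation.
Let `f` be measurable with `e^f` locally integrable and `∫_0^∞ e^{f(u)} du = ∞`. Fix
`x > 0`, `ρ ≥ 0`, `ι ∈ ℝ`, and set `A(s) = ∫_0^s e^{f(u)} du`,
`τ(t) = inf{s ≥ 0 : A(s) > t}`, `m = x A(ρ)`, `g(u) = f(ρ + u) - ι`, `I = x e^ι` and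
`τ̲(r) = inf{s ≥ 0 : ∫_0^s e^{g(u)} du > r}`. Then for every `t ≥ 0`,
`x exp(f(τ((m + t)/x))) = I exp(g(τ̲(t/I)))`. -/
theorem lamperti_post_minimum_path_identity
    (f : ℝ → ℝ) (hf : Measurable f)
    (hloc : ∀ s : ℝ, IntegrableOn (fun u => Real.exp (f u)) (Set.Icc 0 s))
    (hinfty : ∫⁻ u in Set.Ioi (0:ℝ), ENNReal.ofReal (Real.exp (f u)) = ⊤)
    (x ρ ι : ℝ) (hx : 0 < x) (hρ : 0 ≤ ρ)
    (A : ℝ → ℝ) (hA : ∀ s : ℝ, A s = ∫ u in (0:ℝ)..s, Real.exp (f u))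
    (τ : ℝ → ℝ) (hτ : ∀ t : ℝ, τ t = sInf {s : ℝ | 0 ≤ s ∧ A s > t})
    (m : ℝ) (hm : m = x * A ρ)
    (g : ℝ → ℝ) (hg : ∀ u : ℝ, g u = f (ρ + u) - ι)
    (I : ℝ) (hI : I = x * Real.exp ι)
    (τmin : ℝ → ℝ)
    (hτmin : ∀ r : ℝ, τmin r = sInf {s : ℝ | 0 ≤ s ∧ (∫ u in (0:ℝ)..s, Real.exp (g u)) > r}) :
    ∀ t : ℝ, 0 ≤ t →
      x * Real.exp (f (τ ((m + t) / x))) = I * Real.exp (g (τmin (t / I))) := by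
  intro t ht
  have hIpos : 0 < I := hI ▸ mul_pos hx (Real.exp_pos ι)
  have hii : ∀ a b : ℝ, 0 ≤ a → 0 ≤ b →
      IntervalIntegrable (fun u => Real.exp (f u)) volume a b := fun a b ha hb =>
    ((hloc (max a b)).mono_set fun u hu =>
      ⟨(le_min ha hb).trans hu.1, hu.2⟩).intervalIntegrable
  have hmono : ∀ a b : ℝ, 0 ≤ a → a ≤ b → A a ≤ A b := by
    intro a b ha hab
    rw [hA, hA, ← intervalIntegral.integral_add_adjacent_intervals (hii 0 a le_rfl ha)
      (hii a b ha (ha.trans hab))]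
    exact le_add_of_nonneg_right
      (intervalIntegral.integral_nonneg hab fun u _ => (Real.exp_pos _).le)
  have hshift : ∀ s : ℝ, 0 ≤ s →
      A (ρ + s) = A ρ + Real.exp ι * ∫ u in (0:ℝ)..s, Real.exp (g u) := by
    intro s hs
    have hexp : ∀ u, Real.exp ι * Real.exp (g u) = Real.exp (f (ρ + u)) := by
      intro u
      rw [hg, ← Real.exp_add, add_sub_cancel]
    rw [← intervalIntegral.integral_const_mul]
    simp only [hexp]
    rw [intervalIntegral.integral_comp_add_left (fun u => Real.exp (f u)), add_zero, hA, hA,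
      intervalIntegral.integral_add_adjacent_intervals (hii 0 ρ le_rfl hρ)
        (hii ρ (ρ + s) hρ (add_nonneg hρ hs))]
  have hlevel : (m + t) / x = A ρ + Real.exp ι * (t / I) := by
    have hne := (Real.exp_pos ι).ne'
    rw [hm, hI]
    field_simp
  have hlevel_ge : A ρ ≤ (m + t) / x := by
    rw [hlevel]
    exact le_add_of_nonneg_right (by positivity)
  have hiff : ∀ s : ℝ, 0 ≤ s →
      (A (ρ + s) > (m + t) / x ↔ (∫ u in (0:ℝ)..s, Real.exp (g u)) > t / I) := by
    intro s hs
    rw [hshift s hs, hlevel, gt_iff_lt, gt_iff_lt, add_lt_add_iff_left,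
      mul_lt_mul_iff_right₀ (Real.exp_pos ι)]
  have hge : ∀ s : ℝ, 0 ≤ s → A s > (m + t) / x → ρ ≤ s := by
    intro s hs hAs
    by_contra! hlt
    exact absurd (hmono s ρ hs hlt.le) (not_le.2 (hlevel_ge.trans_lt hAs))
  have himage : {s : ℝ | 0 ≤ s ∧ A s > (m + t) / x} =
      (fun s => ρ + s) '' {s : ℝ | 0 ≤ s ∧ (∫ u in (0:ℝ)..s, Real.exp (g u)) > t / I} := by
    ext s
    constructor
    · rintro ⟨hs, hAs⟩
      have hρs := sub_nonneg.2 (hge s hs hAs)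
      exact ⟨s - ρ, ⟨hρs, (hiff _ hρs).1 (by rwa [add_sub_cancel])⟩, add_sub_cancel ρ s⟩
    · rintro ⟨v, ⟨hv, hlt⟩, rfl⟩
      exact ⟨add_nonneg hρ hv, (hiff v hv).2 hlt⟩
  have hnonempty :
      {s : ℝ | 0 ≤ s ∧ (∫ u in (0:ℝ)..s, Real.exp (g u)) > t / I}.Nonempty := by
    rw [← Set.image_nonempty (f := fun s => ρ + s), ← himage]
    obtain ⟨s, hs, hlt⟩ := exists_lt_intervalIntegral_of_lintegral_eq_top
      (fun u => (Real.exp_pos (f u)).le) hloc hinfty ((m + t) / x)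
    exact ⟨s, hs, by rwa [hA]⟩
  have hτ_eq : τ ((m + t) / x) = ρ + τmin (t / I) := by
    rw [hτ, hτmin, himage, csInf_image_const_add ρ hnonempty ⟨0, fun s hs => hs.1⟩]
  rw [hτ_eq, hg, hI, mul_assoc, ← Real.exp_add, add_sub_cancel]

end
end
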